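/- Let (F_p)_{p∈P} be a family of C^r-skew-products satisfying assumptions (U) and (T), and such that the similarity dimension satisfies Δ(p) > N for every p in the closure of P. Then: (1) for every 𝔞 ∈ 𝒜^ℕ, the limit set K_{p,𝔞} has positive N-dimensional Lebesgue measure for Lebesgue-almost every p ∈ P; (2) there exists θ₀ > 0 such that for every parameterized family 𝔽 of θ₀-U-perturbations of (F_p)_{p∈P}, the limit set K̃_{t,p,𝔞} has positive N-dimensional Lebesgue measure for (Leb_d ⊗ Leb_τ)-almost every (p,t) ∈ P × T. -/

import Mathlib

open Filter MeasureTheory Set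
open scoped Topology ENNReal NNReal

noncomputable section

namespace Paper

abbrev E (n : ℕ) : Type := EuclideanSpace ℝ (Fin n)

def cube (N : ℕ) : Set (E N) := {x | ∀ i, x i ∈ Icc (-1:ℝ) 1}

def cubeO (d : ℕ) : Set (E d) := {p | ∀ i, p i ∈ Ioo (-1:ℝ) 1}

variable {A : Type}

def consF (a : A) (𝔞 : ℕ → A) : ℕ → A := fun n =>
  match n with
  | 0 => a
  | Nat.succ k => 𝔞 k

def app : List A → (ℕ → A) → ℕ → A
  | [], 𝔞 => 𝔞
  | a :: w, 𝔞 => app w (consF a 𝔞)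

def trunc (α : ℕ → A) (n : ℕ) : List A := List.ofFn fun i : Fin n => α i

def cyl (w : List A) : Set (ℕ → A) := {α | ∀ i : Fin w.length, α i = w.get i}

variable {N d : ℕ}

def psi (f : E d → (ℕ → A) → E N → E N) (p : E d) : List A → (ℕ → A) → E N → E N
  | [], _ => id
  | a :: w, 𝔞 => f p (consF a 𝔞) ∘ psi f p w (consF a 𝔞)

def dentry (g : E N → E N) (x : E N) (i j : Fin N) : ℝ :=
  fderiv ℝ g x (EuclideanSpace.single j (1:ℝ)) i

def lam (hN : 0 < N) (f : E d → (ℕ → A) → E N → E N) (p : E d) (𝔞 : ℕ → A)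
    (w : List A) (x : E N) : ℝ :=
  |dentry (psi f p w 𝔞) x ⟨0, hN⟩ ⟨0, hN⟩|

def Lam (hN : 0 < N) (f : E d → (ℕ → A) → E N → E N) (p : E d) (𝔞 : ℕ → A)
    (w : List A) : ℝ :=
  sSup ((fun x => lam hN f p 𝔞 w x) '' cube N)

def piProj (f : E d → (ℕ → A) → E N → E N) (p : E d) (𝔞 α : ℕ → A) : E N :=
  limUnder atTop fun n => psi f p (trunc α n) 𝔞 0

def Mop (g : E N → E N) : ℝ := sSup ((fun x => ‖fderiv ℝ g x‖) '' cube N)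

def pressure [Fintype A] (f : E d → (ℕ → A) → E N → E N) (p : E d) (𝔞 : ℕ → A) (s : ℝ) : ℝ :=
  limUnder atTop fun n : ℕ =>
    (1 / n : ℝ) * Real.log (∑ w : Fin n → A, Mop (psi f p (List.ofFn w) 𝔞) ^ s)

structure SkewFamily (A : Type) (N d : ℕ) (r : ℕ∞) where
  f : E d → (ℕ → A) → E N → E N
  X' : Set (E N)
  P' : Set (E d)
  X'_open : IsOpen X'
  X_subset : cube N ⊆ X'
  P'_open : IsOpen P'
  P_subset : closure (cubeO d) ⊆ P'
  smooth : ∀ 𝔞 : ℕ → A, ContDiffOn ℝ r (fun q : E d × E N => f q.1 𝔞 q.2) (P' ×ˢ X')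
  inj : ∀ 𝔞 : ℕ → A, ∀ p ∈ P', Set.InjOn (f p 𝔞) X'
  into : ∀ 𝔞 : ℕ → A, ∀ p ∈ P', f p 𝔞 '' X' ⊆ cube N
  holder0 : ∃ C > (0:ℝ), ∃ θ ∈ Set.Ioo (0:ℝ) 1, ∀ p ∈ P', ∀ (𝔞 𝔟 : ℕ → A) (q : ℕ),
      (∀ i < q, 𝔞 i = 𝔟 i) → ∀ x ∈ X', ‖f p 𝔞 x - f p 𝔟 x‖ ≤ C * θ ^ q
  holder1 : ∃ C > (0:ℝ), ∃ θ ∈ Set.Ioo (0:ℝ) 1, ∀ p ∈ P', ∀ (𝔞 𝔟 : ℕ → A) (q : ℕ),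
      (∀ i < q, 𝔞 i = 𝔟 i) → ∀ x ∈ X',
      ‖fderiv ℝ (f p 𝔞) x - fderiv ℝ (f p 𝔟) x‖ ≤ C * θ ^ q
  cont2 : ∀ p ∈ P', ∀ 𝔞 : ℕ → A, ∀ ε > (0:ℝ), ∃ q : ℕ, ∀ 𝔟 : ℕ → A,
      (∀ i < q, 𝔞 i = 𝔟 i) → ∀ x ∈ X',
      ‖iteratedFDeriv ℝ 2 (f p 𝔞) x - iteratedFDeriv ℝ 2 (f p 𝔟) x‖ ≤ ε

def UnipOn (hN : 0 < N) (f : E d → (ℕ → A) → E N → E N)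
    (P' : Set (E d)) (X' : Set (E N)) : Prop :=
  ∀ p ∈ P', ∀ 𝔞 : ℕ → A, ∀ x ∈ X',
    (∀ i j : Fin N, (i : ℕ) < (j : ℕ) → dentry (f p 𝔞) x i j = 0) ∧
    (∀ i j : Fin N, dentry (f p 𝔞) x i i = dentry (f p 𝔞) x j j) ∧
    0 < |dentry (f p 𝔞) x ⟨0, hN⟩ ⟨0, hN⟩| ∧ |dentry (f p 𝔞) x ⟨0, hN⟩ ⟨0, hN⟩| < 1

def GammaBounds (hN : 0 < N) (f : E d → (ℕ → A) → E N → E N) (γ' γ : ℝ) : Prop :=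
  0 < γ' ∧ γ' < γ ∧ γ < 1 ∧
  ∀ p ∈ closure (cubeO d), ∀ (𝔞 : ℕ → A) (a : A), ∀ x ∈ cube N,
    γ' < lam hN f p 𝔞 [a] x ∧ lam hN f p 𝔞 [a] x < γ

structure ParamPerturb {A : Type} {N d : ℕ} {r : ℕ∞} (hN : 0 < N)
    (S : SkewFamily A N d r) (θ : ℝ) (τ : ℕ) where
  g : E τ → E d → (ℕ → A) → E N → E N
  jointSmooth : ∀ 𝔞 : ℕ → A, ContDiffOn ℝ r
      (fun q : E τ × E d × E N => g q.1 q.2.1 𝔞 q.2.2) ((cubeO τ) ×ˢ S.P' ×ˢ S.X')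
  smooth : ∀ t ∈ cubeO τ, ∀ 𝔞 : ℕ → A, ContDiffOn ℝ r
      (fun q : E d × E N => g t q.1 𝔞 q.2) (S.P' ×ˢ S.X')
  inj : ∀ t ∈ cubeO τ, ∀ 𝔞 : ℕ → A, ∀ p ∈ S.P', Set.InjOn (g t p 𝔞) S.X'
  into : ∀ t ∈ cubeO τ, ∀ 𝔞 : ℕ → A, ∀ p ∈ S.P', g t p 𝔞 '' S.X' ⊆ cube N
  close : ∃ θ' < θ, ∀ t ∈ cubeO τ, ∀ (𝔞 : ℕ → A) (k : ℕ), (k : ℕ∞) ≤ r →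
      ∀ p ∈ S.P', ∀ x ∈ S.X',
      ‖iteratedFDeriv ℝ k (fun q : E d × E N => S.f q.1 𝔞 q.2 - g t q.1 𝔞 q.2) (p, x)‖ ≤ θ'
  unip : ∀ t ∈ cubeO τ, UnipOn hN (g t) S.P' S.X'

def TransAssumption {A : Type} {N d : ℕ} {r : ℕ∞} (hN : 0 < N)
    (S : SkewFamily A N d r) : Prop :=
  ∃ C > (0:ℝ),
    (∀ 𝔞 α β : ℕ → A, α 0 ≠ β 0 → ∀ rr > (0:ℝ),
      volume {p ∈ cubeO d | ‖piProj S.f p 𝔞 α - piProj S.f p 𝔞 β‖ < rr}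
        ≤ ENNReal.ofReal (C * rr ^ N)) ∧
    ∃ θ₀ > (0:ℝ), ∀ θ : ℝ, 0 < θ → θ ≤ θ₀ → ∀ τ : ℕ, 0 < τ →
      ∀ Ft : ParamPerturb hN S θ τ, ∀ t ∈ cubeO τ,
      ∀ 𝔞 α β : ℕ → A, α 0 ≠ β 0 → ∀ rr > (0:ℝ),
        volume {p ∈ cubeO d | ‖piProj (Ft.g t) p 𝔞 α - piProj (Ft.g t) p 𝔞 β‖ < rr}
          ≤ ENNReal.ofReal (C * rr ^ N)

def dens {N : ℕ} (ν : Measure (E N)) (x : E N) : ℝ≥0∞ :=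
  liminf (fun rr : ℝ => ν (Metric.ball x rr) / volume (Metric.ball (0 : E N) rr)) (𝓝[>] (0:ℝ))

end Paper

namespace IFS

open Paper

variable {A : Type}

def psiA (c b : ℝ → A → ℝ) (p : ℝ) : List A → ℝ → ℝ
  | [], x => x
  | a :: w, x => c p a * psiA c b p w x + b p a

def piA (c b : ℝ → A → ℝ) (p : ℝ) (α : ℕ → A) : ℝ :=
  limUnder atTop fun n => psiA c b p (Paper.trunc α n) 0

def LamA (c : ℝ → A → ℝ) (p : ℝ) (w : List A) : ℝ := (w.map fun a => |c p a|).prod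

def IFSHyp (c b : ℝ → A → ℝ) (U : Set ℝ) : Prop :=
  IsOpen U ∧ Icc (-1:ℝ) 1 ⊆ U ∧
  (∀ a : A, ContinuousOn (fun p => c p a) U) ∧
  (∀ a : A, ContinuousOn (fun p => b p a) U) ∧
  (∀ p ∈ U, ∀ a : A, ∀ x ∈ Icc (-1:ℝ) 1, c p a * x + b p a ∈ Ioo (-1:ℝ) 1)

def GammaBoundsA (c : ℝ → A → ℝ) (γ' γ : ℝ) : Prop :=
  0 < γ' ∧ γ' < γ ∧ γ < 1 ∧ ∀ p ∈ Icc (-1:ℝ) 1, ∀ a : A, γ' < |c p a| ∧ |c p a| < γ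

def TransAff (c b : ℝ → A → ℝ) : Prop :=
  ∃ C > (0:ℝ), ∀ α β : ℕ → A, α 0 ≠ β 0 → ∀ rr > (0:ℝ),
    volume {p ∈ Ioo (-1:ℝ) 1 | |piA c b p α - piA c b p β| < rr} ≤ ENNReal.ofReal (C * rr)

def densR (ν : MeasureTheory.Measure ℝ) (x : ℝ) : ℝ≥0∞ :=
  liminf (fun rr : ℝ => ν (Ioo (x - rr) (x + rr)) / ENNReal.ofReal (2 * rr)) (𝓝[>] (0:ℝ))

end IFS

namespace Paper

section aux

variable {A : Type}
variable {N d : ℕ}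

/-! ### Basic facts on the cubes -/

lemma isCompact_cube (n : ℕ) : IsCompact (cube n) := by
  have h : cube n = (EuclideanSpace.equiv (Fin n) ℝ).toHomeomorph ⁻¹'
      (Set.pi univ fun _ : Fin n => Icc (-1:ℝ) 1) := by
    ext x
    simp only [cube, mem_ofPred_eq, mem_preimage, Set.mem_pi, mem_univ, forall_const]
    rfl
  rw [h, Homeomorph.isCompact_preimage]
  exact isCompact_univ_pi fun _ => isCompact_Icc

lemma convex_cube (n : ℕ) : Convex ℝ (cube n) := by
  intro x hx y hy a b ha hb hab i
  have := (convex_Icc (-1:ℝ) 1) (hx i) (hy i) ha hb hab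
  simpa using this

lemma zero_mem_cube (n : ℕ) : (0 : E n) ∈ cube n := by
  intro i
  simp

lemma cubeO_subset_cube (n : ℕ) : cubeO n ⊆ cube n := fun _ hx i =>
  ⟨(hx i).1.le, (hx i).2.le⟩

lemma isOpen_cubeO (n : ℕ) : IsOpen (cubeO n) := by
  have h : cubeO n = (EuclideanSpace.equiv (Fin n) ℝ).toHomeomorph ⁻¹'
      (Set.pi univ fun _ : Fin n => Ioo (-1:ℝ) 1) := by
    ext x
    simp only [cubeO, mem_ofPred_eq, mem_preimage, Set.mem_pi, mem_univ, forall_const]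
    rfl
  rw [h, Homeomorph.isOpen_preimage]
  exact isOpen_set_pi finite_univ fun _ _ => isOpen_Ioo

lemma isCompact_closure_cubeO (n : ℕ) : IsCompact (closure (cubeO n)) :=
  (isCompact_cube n).closure_of_subset (cubeO_subset_cube n)

lemma volume_cubeO_lt_top (n : ℕ) : volume (cubeO n) < ⊤ :=
  lt_of_le_of_lt (measure_mono (cubeO_subset_cube n)) (isCompact_cube n).measure_lt_top

lemma exists_cube_diam (n : ℕ) : ∃ D > (0:ℝ), ∀ x ∈ cube n, ∀ y ∈ cube n, ‖x - y‖ ≤ D := by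
  obtain ⟨R, hR⟩ := (isCompact_cube n).isBounded.exists_norm_le
  refine ⟨2 * |R| + 1, by positivity, fun x hx y hy => ?_⟩
  have h1 := hR x hx
  have h2 := hR y hy
  have h3 := norm_sub_le x y
  have h4 := le_abs_self R
  linarith

/-! ### Compositions of fiber maps -/

def psiH (h : (ℕ → A) → E N → E N) : List A → (ℕ → A) → E N → E N
  | [], _ => id
  | a :: w, 𝔞 => h (consF a 𝔞) ∘ psiH h w (consF a 𝔞)

def piH (h : (ℕ → A) → E N → E N) (𝔞 α : ℕ → A) : E N :=
  limUnder atTop fun n => psiH h (trunc α n) 𝔞 0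

lemma psi_eq (f : E d → (ℕ → A) → E N → E N) (p : E d) (w : List A) (𝔞 : ℕ → A) :
    psi f p w 𝔞 = psiH (f p) w 𝔞 := by
  induction w generalizing 𝔞 with
  | nil => rfl
  | cons a w ih => simp only [psi, psiH, ih]

lemma piProj_eq (f : E d → (ℕ → A) → E N → E N) (p : E d) (𝔞 α : ℕ → A) :
    piProj f p 𝔞 α = piH (f p) 𝔞 α := by
  simp only [piProj, piH, psi_eq]

lemma psiH_append (h : (ℕ → A) → E N → E N) (w v : List A) (𝔞 : ℕ → A) (x : E N) :
    psiH h (w ++ v) 𝔞 x = psiH h w 𝔞 (psiH h v (app w 𝔞) x) := by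
  induction w generalizing 𝔞 with
  | nil => rfl
  | cons a w ih => simp only [psiH, List.cons_append, Function.comp_apply, ih, app]

def shiftF (α : ℕ → A) : ℕ → A := fun n => α (n + 1)

lemma consF_shiftF (α : ℕ → A) : consF (α 0) (shiftF α) = α := by
  funext n
  cases n <;> rfl

lemma trunc_succ (α : ℕ → A) (n : ℕ) : trunc α (n + 1) = α 0 :: trunc (shiftF α) n := by
  simp [trunc, List.ofFn_succ, shiftF]

lemma trunc_succ' (α : ℕ → A) (n : ℕ) : trunc α (n + 1) = trunc α n ++ [α n] := by
  rw [trunc, List.ofFn_succ', List.concat_eq_append]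
  rfl

lemma length_trunc (α : ℕ → A) (n : ℕ) : (trunc α n).length = n := by simp [trunc]

/-- prefixing a sequence with a word -/
def prep : List A → (ℕ → A) → ℕ → A
  | [], α => α
  | a :: w, α => consF a (prep w α)

/-- A comparison function to the norm. -/
structure NormEq (ν : E N → ℝ) (c : ℝ) : Prop where
  c_pos : 0 < c
  le_norm : ∀ v, ν v ≤ ‖v‖
  norm_le : ∀ v, ‖v‖ ≤ c * ν v

lemma NormEq.nonneg {ν : E N → ℝ} {c : ℝ} (H : NormEq ν c) (v : E N) : 0 ≤ ν v := by
  have h1 := H.norm_le v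
  have h2 := norm_nonneg v
  have := H.c_pos
  by_contra hc
  push Not at hc
  nlinarith

/-- Uniform contraction (and lower bounds) for a system of fiber maps. -/
structure Contr (ν : E N → ℝ) (c γ0 γ1 : ℝ) (h : (ℕ → A) → E N → E N) : Prop where
  ne : NormEq ν c
  g0 : 0 < γ0
  g1 : 0 ≤ γ1
  g1' : γ1 < 1
  maps : ∀ 𝔞, ∀ x ∈ cube N, h 𝔞 x ∈ cube N
  up : ∀ 𝔞, ∀ x ∈ cube N, ∀ y ∈ cube N, ν (h 𝔞 x - h 𝔞 y) ≤ γ1 * ν (x - y)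
  lo : ∀ 𝔞, ∀ x ∈ cube N, ∀ y ∈ cube N, γ0 * ν (x - y) ≤ ν (h 𝔞 x - h 𝔞 y)

lemma psiH_mem {h : (ℕ → A) → E N → E N} (hm : ∀ 𝔞, ∀ x ∈ cube N, h 𝔞 x ∈ cube N)
    (w : List A) (𝔞 : ℕ → A) {x : E N} (hx : x ∈ cube N) : psiH h w 𝔞 x ∈ cube N := by
  induction w generalizing 𝔞 with
  | nil => exact hx
  | cons a w ih => exact hm _ _ (ih _)

section contr
variable {ν : E N → ℝ} {c γ0 γ1 : ℝ} {h : (ℕ → A) → E N → E N}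

lemma Contr.psi_up (H : Contr ν c γ0 γ1 h) (w : List A) (𝔞 : ℕ → A) {x y : E N}
    (hx : x ∈ cube N) (hy : y ∈ cube N) :
    ν (psiH h w 𝔞 x - psiH h w 𝔞 y) ≤ γ1 ^ w.length * ν (x - y) := by
  induction w generalizing 𝔞 with
  | nil => simp [psiH]
  | cons a w ih =>
    have h1 := H.up (consF a 𝔞) _ (psiH_mem H.maps w (consF a 𝔞) hx) _
      (psiH_mem H.maps w (consF a 𝔞) hy)
    have h2 := mul_le_mul_of_nonneg_left (ih (consF a 𝔞)) H.g1
    simp only [psiH, Function.comp_apply, List.length_cons, pow_succ']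
    linarith

lemma Contr.pi_tendsto (H : Contr ν c γ0 γ1 h) (𝔞 α : ℕ → A) :
    Tendsto (fun n => psiH h (trunc α n) 𝔞 0) atTop (𝓝 (piH h 𝔞 α)) := by
  obtain ⟨D, hD, hDD⟩ := exists_cube_diam N
  have hc : CauchySeq (fun n => psiH h (trunc α n) 𝔞 0) := by
    refine cauchySeq_of_le_geometric γ1 (c * D) H.g1' fun n => ?_
    rw [trunc_succ', psiH_append, dist_eq_norm]
    have hm : psiH h [α n] (app (trunc α n) 𝔞) 0 ∈ cube N := psiH_mem H.maps _ _ (zero_mem_cube N)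
    have h1 := H.psi_up (trunc α n) 𝔞 (zero_mem_cube N) hm
    rw [length_trunc] at h1
    have h2 := H.ne.norm_le (psiH h (trunc α n) 𝔞 0 -
      psiH h (trunc α n) 𝔞 (psiH h [α n] (app (trunc α n) 𝔞) 0))
    have h3 : ν (0 - psiH h [α n] (app (trunc α n) 𝔞) 0) ≤ D :=
      (H.ne.le_norm _).trans (hDD _ (zero_mem_cube N) _ hm)
    have h4 := mul_le_mul_of_nonneg_left h3 (pow_nonneg H.g1 n)
    have h5 := mul_le_mul_of_nonneg_left (h1.trans h4) H.ne.c_pos.le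
    calc _ ≤ _ := h2
      _ ≤ _ := h5
      _ = _ := by ring
  exact tendsto_nhds_limUnder (cauchySeq_tendsto_of_complete hc)

lemma Contr.pi_mem (H : Contr ν c γ0 γ1 h) (𝔞 α : ℕ → A) : piH h 𝔞 α ∈ cube N :=
  (isCompact_cube N).isClosed.mem_of_tendsto (H.pi_tendsto 𝔞 α)
    (Eventually.of_forall fun _ => psiH_mem H.maps _ _ (zero_mem_cube N))

lemma Contr.pi_shift (H : Contr ν c γ0 γ1 h) (𝔞 α : ℕ → A) :
    piH h 𝔞 α = h (consF (α 0) 𝔞) (piH h (consF (α 0) 𝔞) (shiftF α)) := by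
  have h1 := (tendsto_add_atTop_iff_nat 1).2 (H.pi_tendsto 𝔞 α)
  refine tendsto_nhds_unique h1 ?_
  have h2 := H.pi_tendsto (consF (α 0) 𝔞) (shiftF α)
  simp only [trunc_succ, psiH, Function.comp_apply]
  rw [tendsto_iff_norm_sub_tendsto_zero] at h2 ⊢
  refine squeeze_zero (fun _ => norm_nonneg _) (fun n => ?_)
    (g := fun n => c * γ1 * ‖psiH h (trunc (shiftF α) n) (consF (α 0) 𝔞) 0 -
      piH h (consF (α 0) 𝔞) (shiftF α)‖) (by simpa using h2.const_mul (c * γ1))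
  have h3 := H.up (consF (α 0) 𝔞) _ (psiH_mem H.maps (trunc (shiftF α) n) (consF (α 0) 𝔞)
    (zero_mem_cube N)) _ (H.pi_mem (consF (α 0) 𝔞) (shiftF α))
  have h4 := mul_le_mul_of_nonneg_left (H.ne.le_norm
    (psiH h (trunc (shiftF α) n) (consF (α 0) 𝔞) 0 - piH h (consF (α 0) 𝔞) (shiftF α))) H.g1
  have h5 := mul_le_mul_of_nonneg_left (h3.trans h4) H.ne.c_pos.le
  refine (H.ne.norm_le _).trans (h5.trans_eq (by ring))

lemma Contr.pi_cons (H : Contr ν c γ0 γ1 h) (𝔞 : ℕ → A) (a : A) (α : ℕ → A) :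
    piH h 𝔞 (consF a α) = h (consF a 𝔞) (piH h (consF a 𝔞) α) := by
  have := H.pi_shift 𝔞 (consF a α)
  exact this

lemma Contr.pi_prep (H : Contr ν c γ0 γ1 h) (w : List A) (𝔞 α : ℕ → A) :
    piH h 𝔞 (prep w α) = psiH h w 𝔞 (piH h (app w 𝔞) α) := by
  induction w generalizing 𝔞 with
  | nil => rfl
  | cons a w ih => simp only [prep, H.pi_cons, ih, psiH, Function.comp_apply, app]

lemma Contr.pi_agree (H : Contr ν c γ0 γ1 h) {D : ℝ}
    (hDD : ∀ x ∈ cube N, ∀ y ∈ cube N, ‖x - y‖ ≤ D) (k : ℕ) (𝔞 α β : ℕ → A)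
    (hab : ∀ i < k, α i = β i) : ν (piH h 𝔞 α - piH h 𝔞 β) ≤ γ1 ^ k * D := by
  induction k generalizing 𝔞 α β with
  | zero =>
    simpa using (H.ne.le_norm _).trans (hDD _ (H.pi_mem 𝔞 α) _ (H.pi_mem 𝔞 β))
  | succ k ih =>
    rw [H.pi_shift 𝔞 α, H.pi_shift 𝔞 β, ← hab 0 (Nat.succ_pos k)]
    have h1 := H.up (consF (α 0) 𝔞) _ (H.pi_mem (consF (α 0) 𝔞) (shiftF α)) _
      (H.pi_mem (consF (α 0) 𝔞) (shiftF β))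
    have h2 := ih (consF (α 0) 𝔞) (shiftF α) (shiftF β) fun i hi => hab (i + 1) (by omega)
    have h3 := mul_le_mul_of_nonneg_left h2 H.g1
    calc _ ≤ _ := h1
      _ ≤ _ := h3
      _ = _ := by ring

lemma Contr.isCompact_range [Finite A] (H : Contr ν c γ0 γ1 h) (𝔞 : ℕ → A) :
    IsCompact (range (piH h 𝔞)) := by
  let _ : TopologicalSpace A := ⊥
  have : DiscreteTopology A := ⟨rfl⟩
  obtain ⟨D, hD, hDD⟩ := exists_cube_diam N
  refine _root_.isCompact_range ?_
  rw [continuous_iff_continuousAt]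
  intro α
  rw [ContinuousAt, Metric.tendsto_nhds]
  intro ε hε
  have ht : Tendsto (fun k : ℕ => c * (γ1 ^ k * D)) atTop (𝓝 0) := by
    simpa using ((tendsto_pow_atTop_nhds_zero_of_lt_one H.g1 H.g1').mul_const D).const_mul c
  obtain ⟨k, hk⟩ := (ht.eventually (gt_mem_nhds hε)).exists
  have hev : ∀ᶠ β in 𝓝 α, ∀ i ∈ Finset.range k, β i = α i := by
    rw [Filter.eventually_all_finset]
    intro i _
    have ho : IsOpen ((fun β : ℕ → A => β i) ⁻¹' {α i}) :=
      (isOpen_discrete ({α i} : Set A)).preimage (continuous_apply (A := fun _ : ℕ => A) i)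
    filter_upwards [ho.mem_nhds (mem_singleton _)] with β hβ using hβ
  filter_upwards [hev] with β hβ
  rw [dist_eq_norm]
  refine lt_of_le_of_lt (H.ne.norm_le _) (lt_of_le_of_lt ?_ hk)
  exact mul_le_mul_of_nonneg_left
    (H.pi_agree hDD k 𝔞 β α fun i hi => hβ i (Finset.mem_range.2 hi)) H.ne.c_pos.le

end contr

/-! ### Positive measure from bounded energies -/

lemma energy_cauchy_schwarz {ι : Type*} [Fintype ι] (K : Set (E N)) {ρ : ℝ} (hρ : 0 < ρ)
    (q : ι → ℝ≥0∞) (hq : ∑ i, q i = 1) (x : ι → E N) (hx : ∀ i, x i ∈ K) :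
    volume (Metric.ball (0 : E N) (ρ / 2)) ≤ volume (Metric.thickening ρ K) *
      ∑ i, ∑ j, q i * q j * (if ‖x i - x j‖ < ρ then 1 else 0) := by
  classical
  set V := volume (Metric.ball (0 : E N) (ρ / 2)) with hV
  have hV0 : V ≠ 0 := (Metric.measure_ball_pos volume _ (by positivity)).ne'
  have hVt : V ≠ ⊤ := measure_ball_lt_top.ne
  have hVx : ∀ y : E N, volume (Metric.ball y (ρ / 2)) = V := fun y =>
    Measure.addHaar_ball_center volume y _
  set B : ι → E N → ℝ≥0∞ := fun i => (Metric.ball (x i) (ρ / 2)).indicator 1 with hB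
  have hBm : ∀ i, Measurable (B i) := fun i =>
    measurable_one.indicator measurableSet_ball
  set F : E N → ℝ≥0∞ := fun y => ∑ i, q i * B i y with hF
  have hFm : Measurable F := Finset.measurable_sum _ fun i _ => (hBm i).const_mul _
  have hBi : ∀ i, ∫⁻ y, B i y = V := fun i => by
    rw [hB]
    simp only
    rw [lintegral_indicator_one measurableSet_ball, hVx]
  have hFi : ∫⁻ y, F y = V := by
    rw [hF, lintegral_finsetSum _ fun i _ => (hBm i).const_mul _]
    simp only [lintegral_const_mul _ (hBm _), hBi]
    rw [← Finset.sum_mul, hq, one_mul]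
  set G : E N → ℝ≥0∞ := (Metric.thickening ρ K).indicator 1 with hG
  have hKm : MeasurableSet (Metric.thickening ρ K) := Metric.isOpen_thickening.measurableSet
  have hGm : Measurable G := measurable_one.indicator hKm
  have hFG : ∀ y, F y = F y * G y := by
    intro y
    by_cases hy : y ∈ Metric.thickening ρ K
    · simp [hG, hy]
    · have : F y = 0 := by
        refine Finset.sum_eq_zero fun i _ => ?_
        have : y ∉ Metric.ball (x i) (ρ / 2) := fun hb => hy
          (Metric.mem_thickening_iff.2 ⟨x i, hx i, by
            have := Metric.mem_ball.1 hb
            linarith⟩)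
        simp [hB, this]
      simp [this]
  have hCS := ENNReal.lintegral_mul_le_Lp_mul_Lq volume Real.HolderConjugate.two_two
    hFm.aemeasurable hGm.aemeasurable
  have hL : ∫⁻ y, (F * G) y = V := by
    rw [← hFi]
    exact lintegral_congr fun y => (hFG y).symm
  rw [hL] at hCS
  set a := ∫⁻ y, F y ^ (2:ℝ) with ha
  have hb : ∫⁻ y, G y ^ (2:ℝ) = volume (Metric.thickening ρ K) := by
    rw [← lintegral_indicator_one hKm]
    refine lintegral_congr fun y => ?_
    by_cases hy : y ∈ Metric.thickening ρ K <;> simp [hG, hy]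
  rw [hb] at hCS
  have hsq : ∀ t : ℝ≥0∞, t ^ (1 / (2:ℝ)) * t ^ (1 / (2:ℝ)) = t := fun t => by
    rw [← ENNReal.rpow_add_of_nonneg _ _ (by norm_num) (by norm_num)]
    norm_num
  have h2 : V * V ≤ a * volume (Metric.thickening ρ K) := by
    calc V * V ≤ _ := mul_le_mul' hCS hCS
      _ = (a ^ (1 / (2:ℝ)) * a ^ (1 / (2:ℝ))) * (volume (Metric.thickening ρ K) ^ (1 / (2:ℝ)) *
          volume (Metric.thickening ρ K) ^ (1 / (2:ℝ))) := by ring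
      _ = _ := by rw [hsq, hsq]
  have hBB : ∀ i j, Measurable fun y => B i y * B j y := fun i j => (hBm i).mul (hBm j)
  have h3 : a ≤ (∑ i, ∑ j, q i * q j * (if ‖x i - x j‖ < ρ then 1 else 0)) * V := by
    have : ∀ y, F y ^ (2:ℝ) = ∑ i, ∑ j, q i * q j * (B i y * B j y) := by
      intro y
      rw [ENNReal.rpow_two, sq, hF]
      simp only
      rw [Finset.sum_mul_sum]
      refine Finset.sum_congr rfl fun i _ => Finset.sum_congr rfl fun j _ => by ring
    rw [ha, lintegral_congr this, lintegral_finsetSum _ fun i _ =>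
      Finset.measurable_sum _ fun j _ => (hBB i j).const_mul _, Finset.sum_mul]
    refine Finset.sum_le_sum fun i _ => ?_
    rw [lintegral_finsetSum _ fun j _ => (hBB i j).const_mul _, Finset.sum_mul]
    refine Finset.sum_le_sum fun j _ => ?_
    rw [lintegral_const_mul _ (hBB i j), mul_assoc (q i * q j)]
    refine mul_le_mul' le_rfl ?_
    split_ifs with hij
    · rw [one_mul, ← hBi i]
      refine lintegral_mono fun y => ?_
      by_cases hy : y ∈ Metric.ball (x j) (ρ / 2) <;> simp [hB, hy]
    · rw [zero_mul, nonpos_iff_eq_zero, ← lintegral_zero (μ := (volume : Measure (E N)))]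
      refine lintegral_congr fun y => ?_
      by_cases hy : y ∈ Metric.ball (x i) (ρ / 2)
      · by_cases hy' : y ∈ Metric.ball (x j) (ρ / 2)
        · exfalso
          apply hij
          rw [← dist_eq_norm]
          have h5 := Metric.mem_ball.1 hy
          have h6 := Metric.mem_ball.1 hy'
          have h7 := dist_triangle_left (x i) (x j) y
          linarith
        · simp [hB, hy']
      · simp [hB, hy]
  have h4 : V * V ≤ (volume (Metric.thickening ρ K) *
      ∑ i, ∑ j, q i * q j * (if ‖x i - x j‖ < ρ then 1 else 0)) * V := by
    refine h2.trans ((mul_le_mul' h3 le_rfl).trans_eq (by ring))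
  exact (ENNReal.mul_le_mul_iff_left hV0 hVt).1 h4

lemma pos_of_energy {K : Set (E N)} (hK : IsCompact K) (ρ : ℕ → ℝ) (hρ : ∀ j, 0 < ρ j)
    (hρ0 : Tendsto ρ atTop (𝓝 0)) (e : ℕ → ℝ≥0∞)
    (he : ∀ j, volume (Metric.ball (0 : E N) (ρ j / 2)) ≤
      volume (Metric.thickening (ρ j) K) * e j)
    (hl : liminf (fun j => (ENNReal.ofReal (ρ j ^ N))⁻¹ * e j) atTop < ⊤) : 0 < volume K := by
  by_contra hcon
  have hK0 : volume K = 0 := by simpa using hcon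
  set c0 := ENNReal.ofReal ((1 / 2) ^ N) * volume (Metric.ball (0 : E N) 1) with hc0
  have hc0p : 0 < c0 := by
    refine ENNReal.mul_pos ?_ (Metric.measure_ball_pos volume _ (by positivity)).ne'
    simp
  have hc : ∀ j, c0 ≤ volume (Metric.thickening (ρ j) K) *
      ((ENNReal.ofReal (ρ j ^ N))⁻¹ * e j) := by
    intro j
    have h1 := he j
    have hr0 : ENNReal.ofReal (ρ j ^ N) ≠ 0 := by
      simpa using pow_pos (hρ j) N
    rw [Measure.addHaar_ball_of_pos volume _ (by have := hρ j; positivity)] at h1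
    have h2 : ENNReal.ofReal ((ρ j / 2) ^ Module.finrank ℝ (E N)) =
        ENNReal.ofReal (ρ j ^ N) * ENNReal.ofReal ((1 / 2) ^ N) := by
      rw [← ENNReal.ofReal_mul (pow_nonneg (hρ j).le _), ← mul_pow]
      congr 2
      · ring
      · simp
    rw [h2, mul_assoc, ← hc0] at h1
    calc c0 = (ENNReal.ofReal (ρ j ^ N))⁻¹ * (ENNReal.ofReal (ρ j ^ N) * c0) := by
          rw [← mul_assoc, ENNReal.inv_mul_cancel hr0 ENNReal.ofReal_ne_top, one_mul]
      _ ≤ _ := mul_le_mul' le_rfl h1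
      _ = _ := by ring
  have ht : Tendsto (fun j => volume (Metric.thickening (ρ j) K)) atTop (𝓝 0) := by
    have h1 := tendsto_measure_thickening_of_isClosed (μ := (volume : Measure (E N)))
      (s := K) ⟨1, one_pos, hK.isBounded.thickening.measure_lt_top.ne⟩ hK.isClosed
    rw [hK0] at h1
    exact h1.comp (tendsto_nhdsWithin_iff.2 ⟨hρ0, Eventually.of_forall hρ⟩)
  obtain ⟨L, hL1, hL2⟩ := ENNReal.lt_iff_exists_nnreal_btwn.1 hl
  have hfr : ∃ᶠ j in atTop, (ENNReal.ofReal (ρ j ^ N))⁻¹ * e j < L :=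
    frequently_lt_of_liminf_lt (by isBoundedDefault) hL1
  have ht2 : Tendsto (fun j => volume (Metric.thickening (ρ j) K) * L) atTop (𝓝 0) := by
    simpa using ENNReal.Tendsto.mul_const ht (Or.inr (ENNReal.coe_ne_top (r := L)))
  obtain ⟨j, hj1, hj2⟩ := (hfr.and_eventually (ht2.eventually (gt_mem_nhds hc0p))).exists
  exact absurd ((hc j).trans (mul_le_mul' le_rfl hj1.le)) (not_le.2 hj2)

/-! ### The energy estimate for block Bernoulli weights -/

lemma prep_get (w : List A) (α : ℕ → A) (i : ℕ) (hi : i < w.length) : prep w α i = w[i] := by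
  induction w generalizing i with
  | nil => simp at hi
  | cons a w ih =>
    cases i with
    | zero => rfl
    | succ i =>
      simp only [prep, consF, List.getElem_cons_succ]
      exact ih i (by simpa using hi)

lemma prep_ne {n : ℕ} {b b' : Fin n → A} (hb : b ≠ b') (α β : ℕ → A) :
    ∃ i < n, prep (List.ofFn b) α i ≠ prep (List.ofFn b') β i := by
  obtain ⟨i, hi⟩ := Function.ne_iff.1 hb
  refine ⟨i, i.2, ?_⟩
  rw [prep_get _ _ _ (by simp), prep_get _ _ _ (by simp)]
  simpa using hi

/-- the sequence with prescribed first `k` blocks -/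
def seqW {n : ℕ} (α0 : ℕ → A) : (k : ℕ) → (Fin k → Fin n → A) → ℕ → A
  | 0, _ => α0
  | k + 1, w => prep (List.ofFn (w 0)) (seqW α0 k fun i => w i.succ)

lemma sum_fin_succ_fun {B M : Type*} [Fintype B] [AddCommMonoid M] (k : ℕ)
    (F : (Fin (k + 1) → B) → M) :
    ∑ w, F w = ∑ b : B, ∑ w : Fin k → B, F (Fin.cons b w) := by
  rw [← (Fin.consEquiv (fun _ : Fin (k + 1) => B)).sum_comp, Fintype.sum_prod_type]
  rfl

lemma sum_prod_weights {B : Type*} [Fintype B] (q : B → ℝ) (hq : ∑ b, q b = 1) (k : ℕ) :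
    ∑ w : Fin k → B, ∏ i, q (w i) = 1 := by
  induction k with
  | zero => simp
  | succ k ih =>
    rw [sum_fin_succ_fun]
    simp only [Fin.prod_univ_succ, Fin.cons_zero, Fin.cons_succ, ← Finset.mul_sum, ih, mul_one, hq]

lemma energy_bound [Fintype A] {n : ℕ} (er : (ℕ → A) → (ℕ → A) → (ℕ → A) → ℝ → ℝ)
    {M C1 : ℝ} (hM : ∀ 𝔞 α β ρ, er 𝔞 α β ρ ≤ M) (hM0 : 0 ≤ M) (hC1 : 0 ≤ C1)
    (mb : (Fin n → A) → ℝ) (hmb : ∀ b, 0 < mb b) (hmb1 : ∀ b, mb b ≤ 1)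
    (hZ : 1 < ∑ b, mb b ^ N)
    (hdiff : ∀ b b' : Fin n → A, b ≠ b' → ∀ 𝔞 α β, ∀ ρ > 0,
      er 𝔞 (prep (List.ofFn b) α) (prep (List.ofFn b') β) ρ ≤ C1 * ρ ^ N)
    (hsame : ∀ (b : Fin n → A) (𝔞 α β : ℕ → A), ∀ ρ > 0, er 𝔞 (prep (List.ofFn b) α) (prep (List.ofFn b) β) ρ ≤
      er (app (List.ofFn b) 𝔞) α β (ρ / mb b)) (α0 : ℕ → A) :
    ∃ q : (Fin n → A) → ℝ, (∀ b, 0 ≤ q b) ∧ (∑ b, q b = 1) ∧ ∃ C2 ≥ 0, ∃ η ∈ Ico (0:ℝ) 1,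
      ∀ k 𝔞, ∀ ρ > 0, ∑ w : Fin k → Fin n → A, ∑ v : Fin k → Fin n → A,
        (∏ i, q (w i)) * (∏ i, q (v i)) * er 𝔞 (seqW α0 k w) (seqW α0 k v) ρ
          ≤ C2 * ρ ^ N + η ^ k * M := by
  classical
  set Z := ∑ b, mb b ^ N with hZdef
  have hZ0 : 0 < Z := by linarith
  have hq0 : ∀ b, 0 ≤ mb b ^ N / Z := fun b => div_nonneg (pow_nonneg (hmb b).le _) hZ0.le
  have hq1 : ∑ b, mb b ^ N / Z = 1 := by
    rw [← Finset.sum_div, ← hZdef, div_self hZ0.ne']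
  set q : (Fin n → A) → ℝ := fun b => mb b ^ N / Z with hq
  have hC2 : 0 ≤ C1 * Z / (Z - 1) := div_nonneg (mul_nonneg hC1 hZ0.le) (by linarith)
  set C2 := C1 * Z / (Z - 1) with hC2d
  have hC2e : C1 + C2 / Z = C2 := by
    rw [hC2d]
    have : Z - 1 ≠ 0 := by linarith
    field_simp
    ring
  refine ⟨q, hq0, hq1, C2, hC2, 1 / Z, ⟨by positivity, by
    rw [div_lt_one hZ0]; exact hZ⟩, ?_⟩
  intro k
  induction k with
  | zero =>
    intro 𝔞 ρ hρ
    simp only [Finset.univ_unique, Finset.sum_singleton, Finset.univ_eq_empty,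
      Finset.prod_empty, pow_zero, one_mul]
    have := hM 𝔞 (seqW α0 0 (default : Fin 0 → Fin n → A)) (seqW α0 0 (default : Fin 0 → Fin n → A)) ρ
    have h2 : 0 ≤ C2 * ρ ^ N := mul_nonneg hC2 (pow_nonneg hρ.le _)
    linarith
  | succ k ih =>
    intro 𝔞 ρ hρ
    have hP0 : ∀ w : Fin k → Fin n → A, 0 ≤ ∏ i, q (w i) := fun w =>
      Finset.prod_nonneg fun i _ => hq0 _
    have hPs := sum_prod_weights q hq1 k
    rw [sum_fin_succ_fun]
    have key : ∀ b b' : Fin n → A, ∑ w : Fin k → Fin n → A, ∑ v : Fin k → Fin n → A,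
        (q b * ∏ i, q (w i)) * (q b' * ∏ i, q (v i)) *
          er 𝔞 (prep (List.ofFn b) (seqW α0 k w)) (prep (List.ofFn b') (seqW α0 k v)) ρ ≤
        q b * q b' * (C1 * ρ ^ N) + if b = b' then
          q b / Z * (C2 * ρ ^ N + (1 / Z) ^ k * M) else 0 := by
      intro b b'
      by_cases hbb : b = b'
      · subst hbb
        rw [if_pos rfl]
        have h1 : ∑ w : Fin k → Fin n → A, ∑ v : Fin k → Fin n → A,
            (q b * ∏ i, q (w i)) * (q b * ∏ i, q (v i)) *
            er 𝔞 (prep (List.ofFn b) (seqW α0 k w)) (prep (List.ofFn b) (seqW α0 k v)) ρ ≤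
            q b * q b * (C2 * (ρ / mb b) ^ N + (1 / Z) ^ k * M) := by
          refine le_trans ?_ (mul_le_mul_of_nonneg_left
            (ih (app (List.ofFn b) 𝔞) (ρ / mb b) (div_pos hρ (hmb b)))
            (mul_nonneg (hq0 b) (hq0 b)))
          rw [Finset.mul_sum]
          refine Finset.sum_le_sum fun w _ => ?_
          rw [Finset.mul_sum]
          refine Finset.sum_le_sum fun v _ => ?_
          have h2 := hsame b 𝔞 (seqW α0 k w) (seqW α0 k v) ρ hρ
          have h3 : 0 ≤ (q b * ∏ i, q (w i)) * (q b * ∏ i, q (v i)) :=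
            mul_nonneg (mul_nonneg (hq0 b) (hP0 w)) (mul_nonneg (hq0 b) (hP0 v))
          refine (mul_le_mul_of_nonneg_left h2 h3).trans_eq (by ring)
        have h4 : 0 ≤ q b * q b * (C1 * ρ ^ N) :=
          mul_nonneg (mul_nonneg (hq0 b) (hq0 b)) (mul_nonneg hC1 (pow_nonneg hρ.le _))
        have hmbN : 0 < mb b ^ N := pow_pos (hmb b) N
        have h5 : q b * q b * (C2 * (ρ / mb b) ^ N) = q b / Z * (C2 * ρ ^ N) := by
          rw [hq]
          simp only [div_pow]
          field_simp
        have h6 : q b * q b ≤ q b / Z := by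
          rw [div_eq_mul_inv]
          refine mul_le_mul_of_nonneg_left ?_ (hq0 b)
          rw [hq]
          simp only
          rw [div_eq_mul_inv]
          refine mul_le_of_le_one_left (inv_nonneg.2 hZ0.le) (pow_le_one₀ (hmb b).le (hmb1 b))
        have h7 : q b * q b * ((1 / Z) ^ k * M) ≤ q b / Z * ((1 / Z) ^ k * M) :=
          mul_le_mul_of_nonneg_right h6 (by positivity)
        calc _ ≤ _ := h1
          _ = q b * q b * (C2 * (ρ / mb b) ^ N) + q b * q b * ((1 / Z) ^ k * M) := by ring
          _ ≤ _ := by rw [h5]; linarith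
      · rw [if_neg hbb, add_zero]
        have h1 : ∀ w v : Fin k → Fin n → A, (q b * ∏ i, q (w i)) * (q b' * ∏ i, q (v i)) *
            er 𝔞 (prep (List.ofFn b) (seqW α0 k w)) (prep (List.ofFn b') (seqW α0 k v)) ρ ≤
            (q b * q b' * (C1 * ρ ^ N)) * ((∏ i, q (w i)) * (∏ i, q (v i))) := by
          intro w v
          have h3 : 0 ≤ (q b * ∏ i, q (w i)) * (q b' * ∏ i, q (v i)) :=
            mul_nonneg (mul_nonneg (hq0 b) (hP0 w)) (mul_nonneg (hq0 b') (hP0 v))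
          refine (mul_le_mul_of_nonneg_left (hdiff b b' hbb 𝔞 _ _ ρ hρ) h3).trans_eq (by ring)
        refine (Finset.sum_le_sum fun w _ => Finset.sum_le_sum fun v _ => h1 w v).trans_eq ?_
        simp only [← Finset.mul_sum, hPs, mul_one]
    have hre : ∀ b : Fin n → A, ∑ w : Fin k → Fin n → A, ∑ v : Fin (k + 1) → Fin n → A,
        (∏ i, q ((Fin.cons b w : Fin (k + 1) → Fin n → A) i)) * (∏ i, q (v i)) *
          er 𝔞 (seqW α0 (k + 1) (Fin.cons b w)) (seqW α0 (k + 1) v) ρ =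
        ∑ b' : Fin n → A, ∑ w : Fin k → Fin n → A, ∑ v : Fin k → Fin n → A,
        (q b * ∏ i, q (w i)) * (q b' * ∏ i, q (v i)) *
          er 𝔞 (prep (List.ofFn b) (seqW α0 k w)) (prep (List.ofFn b') (seqW α0 k v)) ρ := by
      intro b
      rw [Finset.sum_comm (s := (Finset.univ : Finset (Fin n → A)))]
      refine Finset.sum_congr rfl fun w _ => ?_
      rw [sum_fin_succ_fun]
      refine Finset.sum_congr rfl fun b' _ => Finset.sum_congr rfl fun v _ => ?_
      simp only [Fin.prod_univ_succ, Fin.cons_zero, Fin.cons_succ, seqW]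
    simp only [hre]
    refine (Finset.sum_le_sum fun b _ => Finset.sum_le_sum fun b' _ => key b b').trans ?_
    simp only [Finset.sum_add_distrib, Finset.sum_ite_eq, Finset.mem_univ, if_true,
      ← Finset.sum_mul, ← Finset.mul_sum, hq1, mul_one, one_mul]
    rw [← Finset.sum_div, hq1, pow_succ]
    apply le_of_eq
    nth_rewrite 2 [← hC2e]
    ring

/-! ### The core transversality argument -/

theorem core [Fintype A] [Nonempty A] {Q : Type*} [MeasurableSpace Q] (m : Measure Q)
    [IsFiniteMeasure m] (h : Q → (ℕ → A) → E N → E N) {ν : E N → ℝ} {c γ0 γ1 : ℝ}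
    (hc : 0 < c) (hγ00 : 0 < γ0) (hγ0 : γ0 ≤ 1)
    (hH : ∀ᵐ q ∂m, Contr ν c γ0 γ1 (h q)) {n : ℕ}
    (mb : (Fin n → A) → ℝ) (hmb : ∀ b, 0 < mb b) (hmb1 : ∀ b, mb b ≤ 1)
    (hZ : 1 < ∑ b, mb b ^ N)
    (hblock : ∀ᵐ q ∂m, ∀ (b : Fin n → A) (𝔞 : ℕ → A), ∀ x ∈ cube N, ∀ y ∈ cube N,
      mb b * ν (x - y) ≤ ν (psiH (h q) (List.ofFn b) 𝔞 x - psiH (h q) (List.ofFn b) 𝔞 y))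
    (hmeas : ∀ 𝔞 α, AEMeasurable (fun q => piH (h q) 𝔞 α) m)
    {C : ℝ} (hC : 0 < C)
    (hTr : ∀ 𝔞 α β : ℕ → A, α 0 ≠ β 0 → ∀ ρ > (0:ℝ),
      m {q | ‖piH (h q) 𝔞 α - piH (h q) 𝔞 β‖ < ρ} ≤ ENNReal.ofReal (C * ρ ^ N))
    (𝔞 : ℕ → A) : ∀ᵐ q ∂m, 0 < volume (range (piH (h q) 𝔞)) := by
  classical
  set er : (ℕ → A) → (ℕ → A) → (ℕ → A) → ℝ → ℝ := fun 𝔞 α β ρ =>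
    m.real {q | ν (piH (h q) 𝔞 α - piH (h q) 𝔞 β) < ρ} with her
  have hmono : ∀ {s t : Set Q}, (∀ᵐ q ∂m, q ∈ s → q ∈ t) → m.real s ≤ m.real t := by
    intro s t hst
    exact ENNReal.toReal_mono (measure_ne_top m t) (measure_mono_ae hst)
  have hdiffn : ∀ (k : ℕ) (𝔞 α β : ℕ → A) (ρ : ℝ), 0 < ρ → (∃ i < k, α i ≠ β i) →
      er 𝔞 α β ρ ≤ C * (c * (ρ / γ0 ^ k)) ^ N := by
    intro k
    induction k with
    | zero =>
      rintro _ _ _ _ _ ⟨i, hi, _⟩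
      omega
    | succ k ih =>
      rintro 𝔞 α β ρ hρ ⟨i, hi, hne⟩
      by_cases h0 : α 0 = β 0
      · have h1 : er 𝔞 α β ρ ≤ er (consF (α 0) 𝔞) (shiftF α) (shiftF β) (ρ / γ0) := by
          refine hmono ?_
          filter_upwards [hH] with q hq hqs
          have h2 : ν (piH (h q) 𝔞 α - piH (h q) 𝔞 β) < ρ := hqs
          show ν (piH (h q) (consF (α 0) 𝔞) (shiftF α) - piH (h q) (consF (α 0) 𝔞) (shiftF β)) <
            ρ / γ0
          rw [hq.pi_shift 𝔞 α, hq.pi_shift 𝔞 β, ← h0] at h2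
          have h3 := hq.lo (consF (α 0) 𝔞) _ (hq.pi_mem (consF (α 0) 𝔞) (shiftF α)) _
            (hq.pi_mem (consF (α 0) 𝔞) (shiftF β))
          rw [lt_div_iff₀ hγ00]
          linarith
        have h4 : ∃ i < k, shiftF α i ≠ shiftF β i := by
          cases i with
          | zero => exact absurd h0 hne
          | succ i => exact ⟨i, by omega, hne⟩
        refine h1.trans ((ih _ _ _ _ (div_pos hρ hγ00) h4).trans_eq ?_)
        rw [pow_succ', div_div]
      · have h1 := hTr 𝔞 α β h0 (c * ρ) (mul_pos hc hρ)
        have h2 : er 𝔞 α β ρ ≤ m.real {q | ‖piH (h q) 𝔞 α - piH (h q) 𝔞 β‖ < c * ρ} := by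
          refine hmono ?_
          filter_upwards [hH] with q hq hqs
          have h2 : ν (piH (h q) 𝔞 α - piH (h q) 𝔞 β) < ρ := hqs
          show ‖piH (h q) 𝔞 α - piH (h q) 𝔞 β‖ < c * ρ
          exact lt_of_le_of_lt (hq.ne.norm_le _) (mul_lt_mul_of_pos_left h2 hc)
        have h3 : m.real {q | ‖piH (h q) 𝔞 α - piH (h q) 𝔞 β‖ < c * ρ} ≤ C * (c * ρ) ^ N :=
          ENNReal.toReal_le_of_le_ofReal (by positivity) h1
        refine h2.trans (h3.trans ?_)
        refine mul_le_mul_of_nonneg_left (pow_le_pow_left₀ (by positivity) ?_ N) hC.le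
        refine mul_le_mul_of_nonneg_left ?_ hc.le
        rw [le_div_iff₀ (by positivity)]
        exact mul_le_of_le_one_right hρ.le (pow_le_one₀ hγ00.le hγ0)
  obtain ⟨a0⟩ := ‹Nonempty A›
  obtain ⟨q, hq0, hq1, C2, hC2, η, hη, hen⟩ := energy_bound (N := N) er (M := m.real univ)
    (C1 := C * (c / γ0 ^ n) ^ N) (fun 𝔞 α β ρ => measureReal_mono (subset_univ _))
    measureReal_nonneg (by positivity) mb hmb hmb1 hZ
    (by
      intro b b' hbb 𝔞 α β ρ hρ
      refine (hdiffn n 𝔞 _ _ ρ hρ (prep_ne hbb α β)).trans_eq ?_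
      rw [mul_assoc, ← mul_pow]
      congr 2
      ring)
    (by
      intro b 𝔞 α β ρ hρ
      refine hmono ?_
      filter_upwards [hH, hblock] with q hq hqb hqs
      have h2 : ν (piH (h q) 𝔞 (prep (List.ofFn b) α) - piH (h q) 𝔞 (prep (List.ofFn b) β)) < ρ :=
        hqs
      show ν (piH (h q) (app (List.ofFn b) 𝔞) α - piH (h q) (app (List.ofFn b) 𝔞) β) < ρ / mb b
      rw [hq.pi_prep, hq.pi_prep] at h2
      have h3 := hqb b 𝔞 _ (hq.pi_mem (app (List.ofFn b) 𝔞) α) _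
        (hq.pi_mem (app (List.ofFn b) 𝔞) β)
      rw [lt_div_iff₀ (hmb b)]
      linarith) (fun _ => a0)
  set α0 : ℕ → A := fun _ => a0
  set ρ : ℕ → ℝ := fun j => 1 / ((j : ℝ) + 1) with hρdef
  have hρ : ∀ j, 0 < ρ j := fun j => by positivity
  have hρ0 : Tendsto ρ atTop (𝓝 0) := tendsto_one_div_add_atTop_nhds_zero_nat
  have hk : ∀ j, ∃ k : ℕ, η ^ k < ρ j ^ N := fun j =>
    exists_pow_lt_of_lt_one (pow_pos (hρ j) N) hη.2
  choose k hk using hk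
  set P : ∀ j, (Fin (k j) → Fin n → A) → ℝ := fun j w => ∏ i, q (w i) with hP
  have hP0 : ∀ j w, 0 ≤ P j w := fun j w => Finset.prod_nonneg fun i _ => hq0 _
  set T : ℕ → (ℕ → A) → (ℕ → A) → Q → ℝ≥0∞ := fun j α β x =>
    if ‖piH (h x) 𝔞 α - piH (h x) 𝔞 β‖ < ρ j then 1 else 0 with hT
  have hTm : ∀ j α β, AEMeasurable (T j α β) m := by
    intro j α β
    have hg : Measurable fun y : E N => if ‖y‖ < ρ j then (1:ℝ≥0∞) else 0 :=
      Measurable.ite (measurableSet_lt measurable_norm measurable_const) measurable_const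
        measurable_const
    exact hg.comp_aemeasurable ((hmeas 𝔞 α).sub (hmeas 𝔞 β))
  set e : ℕ → Q → ℝ≥0∞ := fun j x => ∑ w : Fin (k j) → Fin n → A, ∑ v : Fin (k j) → Fin n → A,
    ENNReal.ofReal (P j w) * ENNReal.ofReal (P j v) * T j (seqW α0 (k j) w) (seqW α0 (k j) v) x
    with he
  have hem : ∀ j, AEMeasurable (e j) m := fun j =>
    Finset.aemeasurable_fun_sum _ fun w _ => Finset.aemeasurable_fun_sum _ fun v _ =>
      (hTm j _ _).const_mul _
  have hTi : ∀ j α β, ∫⁻ x, T j α β x ∂m ≤ ENNReal.ofReal (er 𝔞 α β (ρ j)) := by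
    intro j α β
    have h1 : ∫⁻ x, T j α β x ∂m ≤ m {x | ‖piH (h x) 𝔞 α - piH (h x) 𝔞 β‖ < ρ j} := by
      refine le_trans (le_of_eq (lintegral_congr fun x => ?_)) (lintegral_indicator_one_le _)
      by_cases hx : ‖piH (h x) 𝔞 α - piH (h x) 𝔞 β‖ < ρ j <;> simp [hT, hx]
    refine h1.trans ?_
    rw [her]
    simp only
    rw [measureReal_def, ENNReal.ofReal_toReal (measure_ne_top _ _)]
    refine measure_mono_ae ?_
    filter_upwards [hH] with x hx hxs
    have h2 : ‖piH (h x) 𝔞 α - piH (h x) 𝔞 β‖ < ρ j := hxs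
    show ν (piH (h x) 𝔞 α - piH (h x) 𝔞 β) < ρ j
    exact lt_of_le_of_lt (hx.ne.le_norm _) h2
  have hei : ∀ j, ∫⁻ x, e j x ∂m ≤ ENNReal.ofReal ((C2 + m.real univ) * ρ j ^ N) := by
    intro j
    have h1 : ∫⁻ x, e j x ∂m ≤ ENNReal.ofReal (∑ w : Fin (k j) → Fin n → A,
        ∑ v : Fin (k j) → Fin n → A, P j w * P j v *
          er 𝔞 (seqW α0 (k j) w) (seqW α0 (k j) v) (ρ j)) := by
      have her0 : ∀ α β ρ, 0 ≤ er 𝔞 α β ρ := fun _ _ _ => measureReal_nonneg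
      rw [he, lintegral_finsetSum' _ fun w _ => Finset.aemeasurable_fun_sum _ fun v _ =>
        (hTm j _ _).const_mul _, ENNReal.ofReal_sum_of_nonneg fun w _ => Finset.sum_nonneg
          fun v _ => mul_nonneg (mul_nonneg (hP0 j w) (hP0 j v)) (her0 _ _ _)]
      refine Finset.sum_le_sum fun w _ => ?_
      rw [lintegral_finsetSum' _ fun v _ => (hTm j _ _).const_mul _,
        ENNReal.ofReal_sum_of_nonneg fun v _ =>
          mul_nonneg (mul_nonneg (hP0 j w) (hP0 j v)) (her0 _ _ _)]
      refine Finset.sum_le_sum fun v _ => ?_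
      rw [lintegral_const_mul'' _ (hTm j _ _), ENNReal.ofReal_mul (mul_nonneg (hP0 j w) (hP0 j v)),
        ENNReal.ofReal_mul (hP0 j w)]
      exact mul_le_mul' le_rfl (hTi j _ _)
    refine h1.trans (ENNReal.ofReal_le_ofReal ((hen (k j) 𝔞 (ρ j) (hρ j)).trans ?_))
    have := mul_le_mul_of_nonneg_right (hk j).le (measureReal_nonneg (μ := m) (s := univ))
    linarith
  set I : ℕ → ℝ≥0∞ := fun j => (ENNReal.ofReal (ρ j ^ N))⁻¹ with hI
  have hfat : ∫⁻ x, liminf (fun j => I j * e j x) atTop ∂m < ⊤ := by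
    refine lt_of_le_of_lt (lintegral_liminf_le' fun j => (hem j).const_mul _) ?_
    refine lt_of_le_of_lt (b := ENNReal.ofReal (C2 + m.real univ)) ?_ ENNReal.ofReal_lt_top
    have h1 : ∀ j, ∫⁻ x, I j * e j x ∂m ≤ ENNReal.ofReal (C2 + m.real univ) := by
      intro j
      rw [lintegral_const_mul'' _ (hem j)]
      refine (mul_le_mul' le_rfl (hei j)).trans ?_
      rw [ENNReal.ofReal_mul (by positivity), mul_comm (ENNReal.ofReal (C2 + m.real univ)),
        ← mul_assoc]
      have hr0 : ENNReal.ofReal (ρ j ^ N) ≠ 0 := by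
        simpa using pow_pos (hρ j) N
      rw [hI]
      simp only
      rw [ENNReal.inv_mul_cancel hr0 ENNReal.ofReal_ne_top, one_mul]
    exact (liminf_le_liminf (Eventually.of_forall h1)).trans_eq (liminf_const _)
  have hIe : ∀ j, AEMeasurable (fun x => I j * e j x) m := fun j => (hem j).const_mul _
  have hlm : AEMeasurable (fun x => liminf (fun j => I j * e j x) atTop) m := by
    refine ⟨fun x => liminf (fun j => (hIe j).mk _ x) atTop,
      Measurable.liminf fun j => (hIe j).measurable_mk, ?_⟩
    filter_upwards [ae_all_iff.2 fun j => (hIe j).ae_eq_mk] with x hx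
    simp only [hx]
  have hae := ae_lt_top' hlm hfat.ne
  filter_upwards [hae, hH] with x hx hxH
  refine pos_of_energy (hxH.isCompact_range 𝔞) ρ hρ hρ0 (fun j => e j x) (fun j => ?_) hx
  refine energy_cauchy_schwarz _ (hρ j) (fun w => ENNReal.ofReal (P j w)) ?_
    (fun w => piH (h x) 𝔞 (seqW α0 (k j) w)) fun w => mem_range_self _
  rw [← ENNReal.ofReal_sum_of_nonneg fun w _ => hP0 j w, sum_prod_weights q hq1,
    ENNReal.ofReal_one]

/-! ### Weighted norms and triangular matrices -/

def nrmK (κ : ℝ) (v : E N) : ℝ := ‖(fun i : Fin N => κ ^ (i : ℕ) * v i : Fin N → ℝ)‖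

lemma nrmK_nonneg (κ : ℝ) (v : E N) : 0 ≤ nrmK κ v := norm_nonneg _

lemma nrmK_le_iff {κ : ℝ} (hκ : 0 < κ) (v : E N) {r : ℝ} (hr : 0 ≤ r) :
    nrmK κ v ≤ r ↔ ∀ i : Fin N, κ ^ (i : ℕ) * |v i| ≤ r := by
  rw [nrmK, pi_norm_le_iff_of_nonneg hr]
  refine forall_congr' fun i => ?_
  rw [Real.norm_eq_abs, abs_mul, abs_of_pos (pow_pos hκ _)]

lemma coord_le_nrmK {κ : ℝ} (hκ : 0 < κ) (v : E N) (i : Fin N) :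
    κ ^ (i : ℕ) * |v i| ≤ nrmK κ v :=
  (nrmK_le_iff hκ v (nrmK_nonneg κ v)).1 le_rfl i

lemma abs_coord_le (v : E N) (i : Fin N) : |v i| ≤ ‖v‖ := by
  simpa using PiLp.norm_apply_le v i

lemma nrmK_add_le (κ : ℝ) (u v : E N) : nrmK κ (u + v) ≤ nrmK κ u + nrmK κ v := by
  refine le_trans (le_of_eq ?_) (norm_add_le _ _)
  rw [nrmK]
  congr 1
  funext i
  simp [mul_add]

lemma nrmK_normEq {κ : ℝ} (hκ : 0 < κ) (hκ1 : κ ≤ 1) :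
    NormEq (nrmK κ : E N → ℝ) ((N + 1) / κ ^ N) := by
  refine ⟨by positivity, fun v => ?_, fun v => ?_⟩
  · rw [nrmK_le_iff hκ v (norm_nonneg v)]
    intro i
    exact (mul_le_of_le_one_left (abs_nonneg _) (pow_le_one₀ hκ.le hκ1)).trans (abs_coord_le v i)
  · have h1 : ∀ i, |v i| ≤ nrmK κ v / κ ^ N := by
      intro i
      rw [le_div_iff₀ (by positivity), mul_comm]
      refine le_trans (mul_le_mul_of_nonneg_right ?_ (abs_nonneg _)) (coord_le_nrmK hκ v i)
      exact pow_le_pow_of_le_one hκ.le hκ1 i.2.le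
    have h2 : ‖v‖ ≤ ∑ i, |v i| := by
      have : v = ∑ i, EuclideanSpace.single i (v i) := by
        ext j
        simp [Pi.single_apply]
      calc ‖v‖ = ‖∑ i, EuclideanSpace.single i (v i)‖ := by rw [← this]
        _ ≤ ∑ i, ‖EuclideanSpace.single i (v i)‖ := norm_sum_le _ _
        _ = _ := by simp
    have h3 : ∑ i, |v i| ≤ N * (nrmK κ v / κ ^ N) := by
      refine (Finset.sum_le_sum fun i _ => h1 i).trans_eq ?_
      simp
    have h4 : 0 ≤ nrmK κ v / κ ^ N := div_nonneg (nrmK_nonneg _ _) (by positivity)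
    calc ‖v‖ ≤ N * (nrmK κ v / κ ^ N) := h2.trans h3
      _ ≤ (N + 1) * (nrmK κ v / κ ^ N) := by nlinarith
      _ = _ := by ring

lemma matrix_est {κ ε B δ lo hi : ℝ} (hκ : 0 < κ) (hκ1 : κ ≤ 1) (hB : 0 ≤ B) (hδ : 0 ≤ δ)
    (hε : N * (B * κ + δ / κ ^ N) ≤ ε) (a : Fin N → Fin N → ℝ) (u v : E N)
    (hu : ∀ i, u i = ∑ j, a i j * v j) (hlo0 : 0 ≤ lo) (hhi0 : 0 ≤ hi)
    (hlo : ∀ i, lo ≤ |a i i|) (hhi : ∀ i, |a i i| ≤ hi)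
    (hlow : ∀ i j : Fin N, (j : ℕ) < i → |a i j| ≤ B)
    (hupp : ∀ i j : Fin N, (i : ℕ) < j → |a i j| ≤ δ) :
    (lo - ε) * nrmK κ v ≤ nrmK κ u ∧ nrmK κ u ≤ (hi + ε) * nrmK κ v := by
  have hn0 := nrmK_nonneg κ v
  set n := nrmK κ v with hn
  have hε0 : 0 ≤ ε := le_trans (by positivity) hε
  have hδκ : 0 ≤ δ / κ ^ N := by positivity
  have key : ∀ i : Fin N, |κ ^ (i : ℕ) * u i - κ ^ (i : ℕ) * (a i i * v i)| ≤ ε * n := by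
    intro i
    have h1 : κ ^ (i : ℕ) * u i - κ ^ (i : ℕ) * (a i i * v i) =
        ∑ j, (if j = i then 0 else κ ^ (i : ℕ) * (a i j * v j)) := by
      rw [hu i, Finset.mul_sum, ← Finset.sum_erase_add _ _ (Finset.mem_univ i), add_sub_cancel_right,
        ← Finset.sum_erase_add (s := Finset.univ) (fun j => if j = i then 0 else
          κ ^ (i : ℕ) * (a i j * v j)) (Finset.mem_univ i), if_pos rfl, add_zero]
      refine Finset.sum_congr rfl fun j hj => ?_
      rw [if_neg (Finset.ne_of_mem_erase hj)]
    rw [h1]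
    refine (Finset.abs_sum_le_sum_abs _ _).trans ?_
    have h2 : ∀ j : Fin N, |if j = i then 0 else κ ^ (i : ℕ) * (a i j * v j)| ≤
        (B * κ + δ / κ ^ N) * n := by
      intro j
      have hc := coord_le_nrmK hκ v j
      split_ifs with hji
      · rw [abs_zero]
        positivity
      · rw [abs_mul, abs_mul, abs_of_pos (pow_pos hκ _)]
        rcases lt_or_gt_of_ne (fun hh => hji (Fin.ext hh) : (j : ℕ) ≠ i) with hlt | hgt
        · have h3 : κ ^ (i : ℕ) ≤ κ * κ ^ (j : ℕ) := by
            rw [← pow_succ']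
            exact pow_le_pow_of_le_one hκ.le hκ1 hlt
          have h4 : κ ^ (i : ℕ) * |v j| ≤ κ * n := by
            calc κ ^ (i : ℕ) * |v j| ≤ κ * κ ^ (j : ℕ) * |v j| :=
                  mul_le_mul_of_nonneg_right h3 (abs_nonneg _)
              _ = κ * (κ ^ (j : ℕ) * |v j|) := by ring
              _ ≤ κ * n := mul_le_mul_of_nonneg_left hc hκ.le
          calc κ ^ (i : ℕ) * (|a i j| * |v j|) = |a i j| * (κ ^ (i : ℕ) * |v j|) := by ring
            _ ≤ B * (κ * n) := mul_le_mul (hlow i j hlt) h4 (by positivity) hB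
            _ ≤ _ := by nlinarith [mul_nonneg hδκ hn0]
        · have h4 : |v j| ≤ n / κ ^ N := by
            rw [le_div_iff₀ (by positivity), mul_comm]
            refine le_trans (mul_le_mul_of_nonneg_right ?_ (abs_nonneg _)) hc
            exact pow_le_pow_of_le_one hκ.le hκ1 j.2.le
          have h5 : κ ^ (i : ℕ) * |v j| ≤ n / κ ^ N :=
            (mul_le_of_le_one_left (abs_nonneg _) (pow_le_one₀ hκ.le hκ1)).trans h4
          calc κ ^ (i : ℕ) * (|a i j| * |v j|) = |a i j| * (κ ^ (i : ℕ) * |v j|) := by ring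
            _ ≤ δ * (n / κ ^ N) := mul_le_mul (hupp i j hgt) h5 (by positivity) hδ
            _ = δ / κ ^ N * n := by ring
            _ ≤ _ := by nlinarith [mul_nonneg (mul_nonneg hB hκ.le) hn0]
    refine (Finset.sum_le_sum fun j _ => h2 j).trans ?_
    simp only [Finset.sum_const, Finset.card_univ, Fintype.card_fin, nsmul_eq_mul]
    rw [← mul_assoc]
    exact mul_le_mul_of_nonneg_right hε hn0
  constructor
  · have h1 : nrmK κ v * lo ≤ nrmK κ u + ε * n := by
      rcases hlo0.eq_or_lt with h0 | h0
      · rw [← h0, mul_zero]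
        exact add_nonneg (nrmK_nonneg _ _) (mul_nonneg hε0 hn0)
      rw [← le_div_iff₀ h0, nrmK_le_iff hκ v (div_nonneg (add_nonneg (nrmK_nonneg _ _)
        (mul_nonneg hε0 hn0)) hlo0)]
      intro i
      rw [le_div_iff₀ h0]
      have h2 := key i
      have h3 := coord_le_nrmK hκ u i
      have h4 : κ ^ (i : ℕ) * |v i| * lo ≤ |κ ^ (i : ℕ) * (a i i * v i)| := by
        rw [abs_mul, abs_mul, abs_of_pos (pow_pos hκ _)]
        calc _ = lo * (κ ^ (i : ℕ) * |v i|) := by ring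
          _ ≤ |a i i| * (κ ^ (i : ℕ) * |v i|) :=
            mul_le_mul_of_nonneg_right (hlo i) (by positivity)
          _ = _ := by ring
      have h5 : |κ ^ (i : ℕ) * u i| = κ ^ (i : ℕ) * |u i| := by
        rw [abs_mul, abs_of_pos (pow_pos hκ _)]
      have h6 := abs_sub_abs_le_abs_sub (κ ^ (i : ℕ) * (a i i * v i)) (κ ^ (i : ℕ) * u i)
      rw [abs_sub_comm] at h6
      linarith
    linarith
  · rw [nrmK_le_iff hκ u (mul_nonneg (add_nonneg hhi0 hε0) hn0)]
    intro i
    have h2 := key i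
    have h4 : |κ ^ (i : ℕ) * (a i i * v i)| ≤ hi * n := by
      rw [abs_mul, abs_mul, abs_of_pos (pow_pos hκ _)]
      calc _ = |a i i| * (κ ^ (i : ℕ) * |v i|) := by ring
        _ ≤ hi * n := mul_le_mul (hhi i) (coord_le_nrmK hκ v i) (by positivity) hhi0
    have h5 : |κ ^ (i : ℕ) * u i| = κ ^ (i : ℕ) * |u i| := by
      rw [abs_mul, abs_of_pos (pow_pos hκ _)]
    have h6 := abs_sub_abs_le_abs_sub (κ ^ (i : ℕ) * u i) (κ ^ (i : ℕ) * (a i i * v i))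
    linarith

/-! ### Entries of differentials -/

lemma fderiv_apply_eq_sum (g : E N → E N) (x v : E N) (i : Fin N) :
    fderiv ℝ g x v i = ∑ j, dentry g x i j * v j := by
  have hv : v = ∑ j, v j • EuclideanSpace.single j (1:ℝ) := by
    ext k
    simp [Pi.single_apply]
  conv_lhs => rw [hv]
  rw [map_sum]
  simp only [map_smul, WithLp.ofLp_sum, WithLp.ofLp_smul, Finset.sum_apply, Pi.smul_apply,
    smul_eq_mul, dentry]
  exact Finset.sum_congr rfl fun j _ => mul_comm _ _

lemma dentry_abs_le (g : E N → E N) (x : E N) (i j : Fin N) :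
    |dentry g x i j| ≤ ‖fderiv ℝ g x‖ := by
  refine (abs_coord_le _ i).trans ?_
  have := (fderiv ℝ g x).le_opNorm (EuclideanSpace.single j (1:ℝ))
  simpa using this

lemma dentry_sub_abs_le (g g' : E N → E N) (x x' : E N) (i j : Fin N) :
    |dentry g x i j - dentry g' x' i j| ≤ ‖fderiv ℝ g x - fderiv ℝ g' x'‖ := by
  have h1 := (fderiv ℝ g x - fderiv ℝ g' x').le_opNorm (EuclideanSpace.single j (1:ℝ))
  have h2 := abs_coord_le ((fderiv ℝ g x - fderiv ℝ g' x') (EuclideanSpace.single j (1:ℝ))) i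
  simp only [ContinuousLinearMap.sub_apply, PiLp.norm_single, norm_one, mul_one,
    PiLp.sub_apply] at h1 h2
  exact h2.trans h1

lemma exists_mvt {g : E N → E N} (hg : ∀ x ∈ cube N, DifferentiableAt ℝ g x) {x y : E N}
    (hx : x ∈ cube N) (hy : y ∈ cube N) (i : Fin N) :
    ∃ z ∈ segment ℝ y x, (g x - g y) i = ∑ j, dentry g z i j * (x - y) j := by
  have hs := (convex_cube N).segment_subset hy hx
  have hd : ∀ z ∈ cube N, HasFDerivWithinAt (fun u => g u i)
      ((EuclideanSpace.proj i : E N →L[ℝ] ℝ).comp (fderiv ℝ g z)) (cube N) z := by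
    intro z hz
    exact (((EuclideanSpace.proj i : E N →L[ℝ] ℝ).hasFDerivAt).comp z
      (hg z hz).hasFDerivAt).hasFDerivWithinAt
  obtain ⟨z, hz, he⟩ := domain_mvt hd (convex_cube N) hy hx
  refine ⟨z, hz, ?_⟩
  rw [← fderiv_apply_eq_sum]
  simpa using he

/-! ### One-step estimates for maps near a unipotent system -/

structure Base (f : (ℕ → A) → E N → E N) (φ : (ℕ → A) → E N → ℝ) (γ' γ B : ℝ) : Prop where
  g0 : 0 < γ'
  gg : γ' ≤ γ
  g1 : γ < 1
  B0 : 0 ≤ B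
  maps : ∀ 𝔞, ∀ x ∈ cube N, f 𝔞 x ∈ cube N
  diff : ∀ 𝔞, ∀ x ∈ cube N, DifferentiableAt ℝ (f 𝔞) x
  upp : ∀ 𝔞, ∀ x ∈ cube N, ∀ i j : Fin N, (i : ℕ) < j → dentry (f 𝔞) x i j = 0
  diag : ∀ 𝔞, ∀ x ∈ cube N, ∀ i : Fin N, |dentry (f 𝔞) x i i| = φ 𝔞 x
  plo : ∀ 𝔞, ∀ x ∈ cube N, γ' ≤ φ 𝔞 x
  phi : ∀ 𝔞, ∀ x ∈ cube N, φ 𝔞 x ≤ γ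
  bd : ∀ 𝔞, ∀ x ∈ cube N, ‖fderiv ℝ (f 𝔞) x‖ ≤ B
  uc : ∀ ε > (0:ℝ), ∃ η > (0:ℝ), ∃ q : ℕ, ∀ 𝔞 𝔟 : ℕ → A, (∀ i < q, 𝔞 i = 𝔟 i) →
    ∀ x ∈ cube N, ∀ y ∈ cube N, ‖x - y‖ ≤ η →
      ‖f 𝔞 x - f 𝔟 x‖ ≤ ε ∧ |φ 𝔞 x - φ 𝔟 y| ≤ ε

structure Near (f : (ℕ → A) → E N → E N) (δ : ℝ) (h : (ℕ → A) → E N → E N) : Prop where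
  maps : ∀ 𝔞, ∀ x ∈ cube N, h 𝔞 x ∈ cube N
  diff : ∀ 𝔞, ∀ x ∈ cube N, DifferentiableAt ℝ (h 𝔞) x
  c0 : ∀ 𝔞, ∀ x ∈ cube N, ‖h 𝔞 x - f 𝔞 x‖ ≤ δ
  c1 : ∀ 𝔞, ∀ x ∈ cube N, ‖fderiv ℝ (h 𝔞) x - fderiv ℝ (f 𝔞) x‖ ≤ δ

lemma Near.mono {f h : (ℕ → A) → E N → E N} {δ δ' : ℝ} (H : Near f δ h) (hd : δ ≤ δ') :
    Near f δ' h :=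
  ⟨H.maps, H.diff, fun a x hx => (H.c0 a x hx).trans hd, fun a x hx => (H.c1 a x hx).trans hd⟩

lemma Base.near {f : (ℕ → A) → E N → E N} {φ : (ℕ → A) → E N → ℝ} {γ' γ B : ℝ}
    (H : Base f φ γ' γ B) {δ : ℝ} (hd : 0 ≤ δ) : Near f δ f :=
  ⟨H.maps, H.diff, fun a x hx => by simpa using hd, fun a x hx => by simpa using hd⟩

lemma step_est {f : (ℕ → A) → E N → E N} {φ : (ℕ → A) → E N → ℝ} {γ' γ B : ℝ}
    (H : Base f φ γ' γ B) {R : ℝ} (hR : 1 < R) :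
    ∃ κ > (0:ℝ), κ ≤ 1 ∧ ∃ δ0 > (0:ℝ), ∃ η0 > (0:ℝ), ∀ h, Near f δ0 h → ∀ 𝔞, ∀ x ∈ cube N,
      (∀ y ∈ cube N, γ' / 2 * nrmK κ (x - y) ≤ nrmK κ (h 𝔞 x - h 𝔞 y) ∧
        nrmK κ (h 𝔞 x - h 𝔞 y) ≤ (1 + γ) / 2 * nrmK κ (x - y) ∧
        (‖x - y‖ ≤ η0 → φ 𝔞 x * nrmK κ (x - y) ≤ R * nrmK κ (h 𝔞 x - h 𝔞 y))) ∧
      (∀ v, φ 𝔞 x * nrmK κ v ≤ R * nrmK κ (fderiv ℝ (h 𝔞) x v) ∧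
        nrmK κ (fderiv ℝ (h 𝔞) x v) ≤ R * φ 𝔞 x * nrmK κ v) := by
  have hg0 := H.g0
  have hg1 := H.g1
  have hgg := H.gg
  have hB := H.B0
  have hR0 : 0 < R := by linarith
  have hRi : R⁻¹ < 1 := inv_lt_one_of_one_lt₀ hR
  obtain ⟨ε, hε, h1, h2, h3, h4⟩ : ∃ ε > (0:ℝ), ε ≤ γ' / 4 ∧ ε ≤ (1 - γ) / 4 ∧
      ε ≤ (1 - R⁻¹) * γ' / 3 ∧ ε ≤ (R - 1) * γ' / 3 := by
    have a1 : 0 < γ' / 4 := by positivity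
    have a2 : 0 < (1 - γ) / 4 := by linarith
    have a3 : 0 < (1 - R⁻¹) * γ' / 3 := by
      have : 0 < 1 - R⁻¹ := by linarith
      positivity
    have a4 : 0 < (R - 1) * γ' / 3 := by
      have : 0 < R - 1 := by linarith
      positivity
    refine ⟨min (min (γ' / 4) ((1 - γ) / 4)) (min ((1 - R⁻¹) * γ' / 3) ((R - 1) * γ' / 3)),
      lt_min (lt_min a1 a2) (lt_min a3 a4), ?_, ?_, ?_, ?_⟩ <;> simp
  obtain ⟨κ, hκ, hκ1, hκ2⟩ : ∃ κ > (0:ℝ), κ ≤ 1 ∧ κ ≤ ε / (2 * (N + 1) * (B + 1)) :=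
    ⟨min 1 (ε / (2 * (N + 1) * (B + 1))), lt_min one_pos (by positivity), min_le_left _ _,
      min_le_right _ _⟩
  obtain ⟨δ, hδ, hδ1, hδ2, hδ3⟩ : ∃ δ > (0:ℝ), δ ≤ 1 ∧ δ ≤ ε ∧ δ ≤ ε * κ ^ N / (2 * (N + 1)) :=
    ⟨min (min 1 ε) (ε * κ ^ N / (2 * (N + 1))), lt_min (lt_min one_pos hε) (by positivity),
      by simp, by simp, by simp⟩
  obtain ⟨η, hη, q, huc⟩ := H.uc ε hε
  have hkey : N * ((B + 1) * κ + δ / κ ^ N) ≤ ε := by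
    have b1 : (N + 1) * ((B + 1) * κ) ≤ ε / 2 := by
      rw [le_div_iff₀ (by positivity)] at hκ2
      linarith
    have b2 : (N + 1) * (δ / κ ^ N) ≤ ε / 2 := by
      have hk : 0 < κ ^ N := by positivity
      rw [le_div_iff₀ (by positivity)] at hδ3
      rw [← mul_div_assoc, div_le_iff₀ hk]
      linarith
    have b3 : 0 ≤ (B + 1) * κ + δ / κ ^ N := by positivity
    nlinarith
  refine ⟨κ, hκ, hκ1, δ, hδ, η, hη, fun h hh 𝔞 x hx => ⟨fun y hy => ?_, fun v => ?_⟩⟩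
  · have hs := (convex_cube N).segment_subset hy hx
    choose z hz hzz using fun i => exists_mvt (hh.diff 𝔞) hx hy i
    have hdz : ∀ i j, |dentry (h 𝔞) (z i) i j - dentry (f 𝔞) (z i) i j| ≤ δ := fun i j =>
      (dentry_sub_abs_le _ _ _ _ _ _).trans (hh.c1 𝔞 (z i) (hs (hz i)))
    have hlow : ∀ i j : Fin N, (j : ℕ) < i → |dentry (h 𝔞) (z i) i j| ≤ B + 1 := by
      intro i j _
      have c1 := (dentry_abs_le (f 𝔞) (z i) i j).trans (H.bd 𝔞 _ (hs (hz i)))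
      have c2 := hdz i j
      have c3 := abs_sub_abs_le_abs_sub (dentry (h 𝔞) (z i) i j) (dentry (f 𝔞) (z i) i j)
      linarith
    have hupp : ∀ i j : Fin N, (i : ℕ) < j → |dentry (h 𝔞) (z i) i j| ≤ δ := by
      intro i j hij
      have c2 := hdz i j
      rwa [H.upp 𝔞 _ (hs (hz i)) i j hij, sub_zero] at c2
    have hdg : ∀ i, |dentry (h 𝔞) (z i) i i| ≤ φ 𝔞 (z i) + ε ∧
        φ 𝔞 (z i) - ε ≤ |dentry (h 𝔞) (z i) i i| := by
      intro i
      have c1 := H.diag 𝔞 _ (hs (hz i)) i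
      have c2 := hdz i i
      have c3 := abs_sub_abs_le_abs_sub (dentry (h 𝔞) (z i) i i) (dentry (f 𝔞) (z i) i i)
      have c4 := abs_sub_abs_le_abs_sub (dentry (f 𝔞) (z i) i i) (dentry (h 𝔞) (z i) i i)
      rw [abs_sub_comm] at c4
      constructor <;> linarith
    have hhi : ∀ i, |dentry (h 𝔞) (z i) i i| ≤ γ + ε := fun i => by
      have := (hdg i).1
      have := H.phi 𝔞 _ (hs (hz i))
      linarith
    have m1 := matrix_est hκ hκ1 (by linarith : 0 ≤ B + 1) hδ.le hkey
      (fun i j => dentry (h 𝔞) (z i) i j) (h 𝔞 x - h 𝔞 y) (x - y) hzz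
      (lo := γ' - ε) (hi := γ + ε) (by linarith) (by linarith)
      (fun i => by
        have := (hdg i).2
        have := H.plo 𝔞 _ (hs (hz i))
        linarith) hhi hlow hupp
    have hn := nrmK_nonneg κ (x - y)
    refine ⟨le_trans ?_ m1.1, m1.2.trans ?_, fun hxy => ?_⟩
    · exact mul_le_mul_of_nonneg_right (by linarith) hn
    · exact mul_le_mul_of_nonneg_right (by linarith) hn
    · have hp := H.plo 𝔞 x hx
      have m2 := matrix_est hκ hκ1 (by linarith : 0 ≤ B + 1) hδ.le hkey
        (fun i j => dentry (h 𝔞) (z i) i j) (h 𝔞 x - h 𝔞 y) (x - y) hzz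
        (lo := φ 𝔞 x - 2 * ε) (hi := γ + ε) (by linarith) (by linarith)
        (fun i => by
          have e1 := (hdg i).2
          have e2 : ‖x - z i‖ ≤ η := by
            refine le_trans ?_ hxy
            have := norm_sub_le_of_mem_segment (hz i)
            rw [norm_sub_rev]
            have e5 := hz i
            rw [segment_symm] at e5
            have := norm_sub_le_of_mem_segment e5
            rwa [norm_sub_rev y x] at this
          have e3 := (huc 𝔞 𝔞 (fun _ _ => rfl) x hx _ (hs (hz i)) e2).2
          have e4 := (abs_le.1 e3).2
          linarith) hhi hlow hupp
      have e6 : R⁻¹ * φ 𝔞 x * nrmK κ (x - y) ≤ nrmK κ (h 𝔞 x - h 𝔞 y) := by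
        refine le_trans (mul_le_mul_of_nonneg_right ?_ hn) m2.1
        nlinarith
      have e7 := mul_le_mul_of_nonneg_left e6 hR0.le
      calc _ = R * (R⁻¹ * φ 𝔞 x * nrmK κ (x - y)) := by field_simp
        _ ≤ _ := e7
  · have hdz : ∀ i j, |dentry (h 𝔞) x i j - dentry (f 𝔞) x i j| ≤ δ := fun i j =>
      (dentry_sub_abs_le _ _ _ _ _ _).trans (hh.c1 𝔞 x hx)
    have hlow : ∀ i j : Fin N, (j : ℕ) < i → |dentry (h 𝔞) x i j| ≤ B + 1 := by
      intro i j _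
      have c1 := (dentry_abs_le (f 𝔞) x i j).trans (H.bd 𝔞 _ hx)
      have c2 := hdz i j
      have c3 := abs_sub_abs_le_abs_sub (dentry (h 𝔞) x i j) (dentry (f 𝔞) x i j)
      linarith
    have hupp : ∀ i j : Fin N, (i : ℕ) < j → |dentry (h 𝔞) x i j| ≤ δ := by
      intro i j hij
      have c2 := hdz i j
      rwa [H.upp 𝔞 _ hx i j hij, sub_zero] at c2
    have hdg : ∀ i, |dentry (h 𝔞) x i i| ≤ φ 𝔞 x + ε ∧
        φ 𝔞 x - ε ≤ |dentry (h 𝔞) x i i| := by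
      intro i
      have c1 := H.diag 𝔞 _ hx i
      have c2 := hdz i i
      have c3 := abs_sub_abs_le_abs_sub (dentry (h 𝔞) x i i) (dentry (f 𝔞) x i i)
      have c4 := abs_sub_abs_le_abs_sub (dentry (f 𝔞) x i i) (dentry (h 𝔞) x i i)
      rw [abs_sub_comm] at c4
      constructor <;> linarith
    have hp := H.plo 𝔞 x hx
    have m1 := matrix_est hκ hκ1 (by linarith : 0 ≤ B + 1) hδ.le hkey
      (fun i j => dentry (h 𝔞) x i j) (fderiv ℝ (h 𝔞) x v) v
      (fun i => fderiv_apply_eq_sum _ _ _ _)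
      (lo := φ 𝔞 x - ε) (hi := φ 𝔞 x + ε) (by linarith) (by linarith)
      (fun i => (hdg i).2) (fun i => (hdg i).1) hlow hupp
    have hn := nrmK_nonneg κ v
    constructor
    · have e6 : R⁻¹ * φ 𝔞 x * nrmK κ v ≤ nrmK κ (fderiv ℝ (h 𝔞) x v) := by
        refine le_trans (mul_le_mul_of_nonneg_right ?_ hn) m1.1
        nlinarith
      have e7 := mul_le_mul_of_nonneg_left e6 hR0.le
      calc _ = R * (R⁻¹ * φ 𝔞 x * nrmK κ v) := by field_simp
        _ ≤ _ := e7
    · refine m1.2.trans (mul_le_mul_of_nonneg_right ?_ hn)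
      nlinarith

/-! ### Distortion -/

def PhiH (φ : (ℕ → A) → E N → ℝ) (h : (ℕ → A) → E N → E N) : List A → (ℕ → A) → E N → ℝ
  | [], _, _ => 1
  | a :: w, 𝔞, x => φ (consF a 𝔞) (psiH h w (consF a 𝔞) x) * PhiH φ h w (consF a 𝔞) x

lemma PhiH_append (φ : (ℕ → A) → E N → ℝ) (h : (ℕ → A) → E N → E N) (w v : List A)
    (𝔞 : ℕ → A) (x : E N) :
    PhiH φ h (w ++ v) 𝔞 x = PhiH φ h w 𝔞 (psiH h v (app w 𝔞) x) * PhiH φ h v (app w 𝔞) x := by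
  induction w generalizing 𝔞 with
  | nil => simp [PhiH, app]
  | cons a w ih =>
    simp only [PhiH, List.cons_append, ih, app, psiH_append]
    ring

lemma PhiH_bounds {f : (ℕ → A) → E N → E N} {φ : (ℕ → A) → E N → ℝ} {γ' γ B : ℝ}
    (H : Base f φ γ' γ B) {h : (ℕ → A) → E N → E N}
    (hm : ∀ 𝔞, ∀ x ∈ cube N, h 𝔞 x ∈ cube N) (w : List A) (𝔞 : ℕ → A) {x : E N}
    (hx : x ∈ cube N) : γ' ^ w.length ≤ PhiH φ h w 𝔞 x ∧ PhiH φ h w 𝔞 x ≤ γ ^ w.length := by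
  have hg0 := H.g0
  induction w generalizing 𝔞 with
  | nil => simp [PhiH]
  | cons a w ih =>
    have h1 := ih (consF a 𝔞)
    have hm' := psiH_mem hm w (consF a 𝔞) hx
    have h2 := H.plo (consF a 𝔞) _ hm'
    have h3 := H.phi (consF a 𝔞) _ hm'
    simp only [PhiH, List.length_cons, pow_succ']
    have hp : 0 < γ' ^ w.length := by positivity
    exact ⟨mul_le_mul h2 h1.1 hp.le (by linarith),
      mul_le_mul h3 h1.2 (hp.le.trans h1.1) (by linarith [H.gg])⟩

lemma PhiH_pos {f : (ℕ → A) → E N → E N} {φ : (ℕ → A) → E N → ℝ} {γ' γ B : ℝ}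
    (H : Base f φ γ' γ B) {h : (ℕ → A) → E N → E N}
    (hm : ∀ 𝔞, ∀ x ∈ cube N, h 𝔞 x ∈ cube N) (w : List A) (𝔞 : ℕ → A) {x : E N}
    (hx : x ∈ cube N) : 0 < PhiH φ h w 𝔞 x :=
  lt_of_lt_of_le (pow_pos H.g0 _) (PhiH_bounds H hm w 𝔞 hx).1

lemma psiH_diff {h : (ℕ → A) → E N → E N}
    (hm : ∀ 𝔞, ∀ x ∈ cube N, h 𝔞 x ∈ cube N)
    (hd : ∀ 𝔞, ∀ x ∈ cube N, DifferentiableAt ℝ (h 𝔞) x) (w : List A) (𝔞 : ℕ → A) {x : E N}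
    (hx : x ∈ cube N) : DifferentiableAt ℝ (psiH h w 𝔞) x := by
  induction w generalizing 𝔞 with
  | nil => exact differentiableAt_id
  | cons a w ih =>
    exact (hd _ _ (psiH_mem hm w (consF a 𝔞) hx)).comp x (ih (consF a 𝔞))

/-- Output of the distortion estimates. -/
structure Distort (f : (ℕ → A) → E N → E N) (φ : (ℕ → A) → E N → ℝ) (R : ℝ)
    (ν : E N → ℝ) (c γ0 γ1 δ K : ℝ) : Prop where
  δpos : 0 < δ
  Kone : 1 ≤ K
  g0one : γ0 ≤ 1
  contr : ∀ h, Near f δ h → Contr ν c γ0 γ1 h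
  ratio : ∀ h h', Near f δ h → Near f δ h' → ∀ (w : List A) (𝔞 𝔟 : ℕ → A), ∀ x ∈ cube N,
    ∀ y ∈ cube N, PhiH φ h w 𝔞 x ≤ K * R ^ w.length * PhiH φ h' w 𝔟 y
  low : ∀ h, Near f δ h → ∀ (w : List A) (𝔞 : ℕ → A), ∀ x ∈ cube N, ∀ y ∈ cube N,
    PhiH φ h w 𝔞 x * ν (x - y) ≤ K * R ^ w.length * ν (psiH h w 𝔞 x - psiH h w 𝔞 y)
  dlow : ∀ h, Near f δ h → ∀ (w : List A) (𝔞 : ℕ → A), ∀ x ∈ cube N, ∀ v,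
    PhiH φ h w 𝔞 x * ν v ≤ R ^ w.length * ν (fderiv ℝ (psiH h w 𝔞) x v)
  dup : ∀ h, Near f δ h → ∀ (w : List A) (𝔞 : ℕ → A), ∀ x ∈ cube N, ∀ v,
    ν (fderiv ℝ (psiH h w 𝔞) x v) ≤ R ^ w.length * PhiH φ h w 𝔞 x * ν v

lemma exists_distort {f : (ℕ → A) → E N → E N} {φ : (ℕ → A) → E N → ℝ} {γ' γ B : ℝ}
    (H : Base f φ γ' γ B) {R : ℝ} (hR : 1 < R) :
    ∃ ν c γ0 γ1 δ K, Distort f φ R ν c γ0 γ1 δ K := by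
  have hg0 := H.g0
  have hg1 := H.g1
  have hgg := H.gg
  have hR0 : 0 < R := by linarith
  obtain ⟨κ, hκ, hκ1, δ0, hδ0, η0, hη0, hst⟩ := step_est H hR
  have hne := nrmK_normEq (N := N) hκ hκ1
  set ν : E N → ℝ := nrmK κ with hν
  set c : ℝ := (N + 1) / κ ^ N with hc
  set γ1 : ℝ := (1 + γ) / 2 with hγ1
  set γ0 : ℝ := γ' / 2 with hγ0
  have hc0 := hne.c_pos
  have hγ10 : 0 ≤ γ1 := by rw [hγ1]; linarith
  have hγ11 : γ1 < 1 := by rw [hγ1]; linarith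
  have hcontr0 : ∀ h, Near f δ0 h → Contr ν c γ0 γ1 h := fun h hh =>
    ⟨hne, by positivity, hγ10, hγ11, hh.maps, fun 𝔞 x hx y hy => ((hst h hh 𝔞 x hx).1 y hy).2.1,
      fun 𝔞 x hx y hy => ((hst h hh 𝔞 x hx).1 y hy).1⟩
  obtain ⟨D, hD, hDD⟩ := exists_cube_diam N
  -- uniform continuity scale for the ratio
  obtain ⟨η, hη, q', huc⟩ := H.uc ((R - 1) * γ') (mul_pos (by linarith) hg0)
  -- the drift e
  obtain ⟨e, he, hce⟩ : ∃ e > (0:ℝ), c * (e / (1 - γ1)) ≤ η / 2 := by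
    have : 0 < 1 - γ1 := by linarith
    refine ⟨η * (1 - γ1) / (2 * c), by positivity, le_of_eq ?_⟩
    field_simp
  obtain ⟨η2, hη2, q'', huc2⟩ := H.uc (e / 2) (by positivity)
  obtain ⟨δ, hδ, hδ1, hδ2⟩ : ∃ δ > (0:ℝ), δ ≤ δ0 ∧ δ ≤ e / 4 :=
    ⟨min δ0 (e / 4), lt_min hδ0 (by positivity), by simp, by simp⟩
  set q1 := max q' q'' with hq1
  have hpow : Tendsto (fun k : ℕ => c * (γ1 ^ k * D)) atTop (𝓝 0) := by
    simpa using ((tendsto_pow_atTop_nhds_zero_of_lt_one hγ10 hγ11).mul_const D).const_mul c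
  obtain ⟨q0, hq0⟩ := eventually_atTop.1 (hpow.eventually (gt_mem_nhds
    (lt_min (half_pos hη) hη0)))
  have hq0a : ∀ k ≥ q0, c * (γ1 ^ k * D) ≤ η / 2 := fun k hk =>
    ((hq0 k hk).trans_le (min_le_left _ _)).le
  have hq0b : ∀ k ≥ q0, c * (γ1 ^ k * D) ≤ η0 := fun k hk =>
    ((hq0 k hk).trans_le (min_le_right _ _)).le
  set G : ℝ := 2 * γ / γ' with hG
  have hG1 : 1 ≤ G := by
    rw [hG, le_div_iff₀ hg0]
    linarith
  have hG0 : 0 < G := by linarith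
  have hNear : ∀ h, Near f δ h → Near f δ0 h := fun h hh => hh.mono hδ1
  have hcontr : ∀ h, Near f δ h → Contr ν c γ0 γ1 h := fun h hh => hcontr0 h (hNear h hh)
  -- agreement is inherited
  have hag : ∀ (j : ℕ) (a : A) (𝔞 𝔟 : ℕ → A), (∀ i < j, 𝔞 i = 𝔟 i) →
      ∀ i < j + 1, consF a 𝔞 i = consF a 𝔟 i := by
    intro j a 𝔞 𝔟 hj i hi
    cases i with
    | zero => rfl
    | succ i => exact hj i (by omega)
  -- orbit distance
  have horb : ∀ h h', Near f δ h → Near f δ h' → ∀ (w : List A) (𝔞 𝔟 : ℕ → A),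
      (∀ i < q1, 𝔞 i = 𝔟 i) → ∀ x ∈ cube N, ∀ y ∈ cube N,
      ν (psiH h w 𝔞 x - psiH h' w 𝔟 y) ≤ γ1 ^ w.length * D + e / (1 - γ1) := by
    intro h h' hh hh' w
    have h1γ : 0 < 1 - γ1 := by linarith
    induction w with
    | nil =>
      intro 𝔞 𝔟 _ x hx y hy
      have := (hne.le_norm (x - y)).trans (hDD x hx y hy)
      have h3 : 0 ≤ e / (1 - γ1) := by positivity
      simp only [psiH, List.length_nil, pow_zero, one_mul, id]
      linarith
    | cons a w ih =>
      intro 𝔞 𝔟 hab x hx y hy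
      have hab' := hag q1 a 𝔞 𝔟 hab
      have hab'' : ∀ i < q1, consF a 𝔞 i = consF a 𝔟 i := fun i hi => hab' i (by omega)
      have h1 := ih (consF a 𝔞) (consF a 𝔟) hab'' x hx y hy
      have hu := psiH_mem hh.maps w (consF a 𝔞) hx
      have hu' := psiH_mem hh'.maps w (consF a 𝔟) hy
      simp only [psiH, Function.comp_apply, List.length_cons]
      set u := psiH h w (consF a 𝔞) x
      set u' := psiH h' w (consF a 𝔟) y
      have h2 := (hcontr h hh).up (consF a 𝔞) u hu u' hu'
      have h3 : ν (h (consF a 𝔞) u' - h' (consF a 𝔟) u') ≤ e := by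
        refine (hne.le_norm _).trans ?_
        have k1 := hh.c0 (consF a 𝔞) u' hu'
        have k2 := hh'.c0 (consF a 𝔟) u' hu'
        have k3 := (huc2 (consF a 𝔞) (consF a 𝔟) (fun i hi => hab'' i
          (lt_of_lt_of_le hi (le_max_right _ _))) u' hu' u' hu' (by simpa using hη2.le)).1
        rw [norm_sub_rev] at k2
        calc _ = ‖(h (consF a 𝔞) u' - f (consF a 𝔞) u') + (f (consF a 𝔞) u' - f (consF a 𝔟) u')
              + (f (consF a 𝔟) u' - h' (consF a 𝔟) u')‖ := by congr 1; abel
          _ ≤ _ := norm_add₃_le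
          _ ≤ e := by linarith
      have h4 := nrmK_add_le κ (h (consF a 𝔞) u - h (consF a 𝔞) u')
        (h (consF a 𝔞) u' - h' (consF a 𝔟) u')
      rw [sub_add_sub_cancel] at h4
      have h5 := mul_le_mul_of_nonneg_left h1 hγ10
      have h6 : γ1 * (γ1 ^ w.length * D + e / (1 - γ1)) + e =
          γ1 ^ (w.length + 1) * D + e / (1 - γ1) := by
        field_simp
        ring
      linarith
  -- one-factor comparison
  have hfacG : ∀ 𝔞 𝔟, ∀ u ∈ cube N, ∀ u' ∈ cube N, φ 𝔞 u ≤ G * φ 𝔟 u' := by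
    intro 𝔞 𝔟 u hu u' hu'
    have h1 := H.phi 𝔞 u hu
    have h2 := H.plo 𝔟 u' hu'
    have h3 := mul_le_mul_of_nonneg_left h2 hG0.le
    have h4 : G * γ' = 2 * γ := by rw [hG]; field_simp
    linarith
  have hratio : ∀ h h', Near f δ h → Near f δ h' → ∀ (w : List A) (j : ℕ) (𝔞 𝔟 : ℕ → A),
      (∀ i < j, 𝔞 i = 𝔟 i) → ∀ x ∈ cube N, ∀ y ∈ cube N,
      PhiH φ h w 𝔞 x ≤ G ^ (min w.length q0 + (q1 - j)) * R ^ w.length * PhiH φ h' w 𝔟 y := by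
    intro h h' hh hh' w
    induction w with
    | nil =>
      intro j 𝔞 𝔟 _ x _ y _
      simpa [PhiH] using one_le_pow₀ hG1
    | cons a w ih =>
      intro j 𝔞 𝔟 hab x hx y hy
      have hab' := hag j a 𝔞 𝔟 hab
      have h1 := ih (j + 1) (consF a 𝔞) (consF a 𝔟) hab' x hx y hy
      have hu := psiH_mem hh.maps w (consF a 𝔞) hx
      have hu' := psiH_mem hh'.maps w (consF a 𝔟) hy
      have hP' := PhiH_pos H hh'.maps w (consF a 𝔟) hy
      have hP := PhiH_pos H hh.maps w (consF a 𝔞) hx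
      simp only [PhiH, List.length_cons]
      have hGφ := hfacG (consF a 𝔞) (consF a 𝔟) _ hu _ hu'
      have hφ' : 0 < φ (consF a 𝔟) (psiH h' w (consF a 𝔟) y) :=
        lt_of_lt_of_le hg0 (H.plo _ _ hu')
      have hgen : ∀ s : ℝ, 0 ≤ s → φ (consF a 𝔞) (psiH h w (consF a 𝔞) x) ≤
          s * φ (consF a 𝔟) (psiH h' w (consF a 𝔟) y) →
          s * (G ^ (min w.length q0 + (q1 - (j + 1))) * R ^ w.length) ≤
            G ^ (min (w.length + 1) q0 + (q1 - j)) * R ^ (w.length + 1) →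
          φ (consF a 𝔞) (psiH h w (consF a 𝔞) x) * PhiH φ h w (consF a 𝔞) x ≤
          G ^ (min (w.length + 1) q0 + (q1 - j)) * R ^ (w.length + 1) *
            (φ (consF a 𝔟) (psiH h' w (consF a 𝔟) y) * PhiH φ h' w (consF a 𝔟) y) := by
        intro s hs hs1 hs2
        calc _ ≤ (s * φ (consF a 𝔟) (psiH h' w (consF a 𝔟) y)) *
              (G ^ (min w.length q0 + (q1 - (j + 1))) * R ^ w.length *
                PhiH φ h' w (consF a 𝔟) y) :=
              mul_le_mul hs1 h1 hP.le (by positivity)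
          _ = s * (G ^ (min w.length q0 + (q1 - (j + 1))) * R ^ w.length) *
              (φ (consF a 𝔟) (psiH h' w (consF a 𝔟) y) * PhiH φ h' w (consF a 𝔟) y) := by ring
          _ ≤ _ := mul_le_mul_of_nonneg_right hs2 (by positivity)
      have hRR : R ^ w.length ≤ R ^ (w.length + 1) := pow_le_pow_right₀ hR.le (by omega)
      have hcaseG : min w.length q0 + (q1 - (j + 1)) + 1 ≤ min (w.length + 1) q0 + (q1 - j) →
          φ (consF a 𝔞) (psiH h w (consF a 𝔞) x) * PhiH φ h w (consF a 𝔞) x ≤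
          G ^ (min (w.length + 1) q0 + (q1 - j)) * R ^ (w.length + 1) *
            (φ (consF a 𝔟) (psiH h' w (consF a 𝔟) y) * PhiH φ h' w (consF a 𝔟) y) := by
        intro hle
        refine hgen G hG0.le hGφ ?_
        rw [← mul_assoc, ← pow_succ']
        exact mul_le_mul (pow_le_pow_right₀ hG1 hle) hRR (by positivity) (by positivity)
      by_cases hj : j < q1
      · exact hcaseG (by omega)
      · by_cases hw : w.length < q0
        · exact hcaseG (by omega)
        · push Not at hj hw
          refine hgen R hR0.le ?_ ?_
          · have k0 : ∀ i < q1, consF a 𝔞 i = consF a 𝔟 i := fun i hi => hab' i (by omega)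
            have k1 := horb h h' hh hh' w (consF a 𝔞) (consF a 𝔟) k0 x hx y hy
            have k2 := hne.norm_le (psiH h w (consF a 𝔞) x - psiH h' w (consF a 𝔟) y)
            have k3 := mul_le_mul_of_nonneg_left k1 hc0.le
            have k4 := hq0a _ hw
            have k5 : ‖psiH h w (consF a 𝔞) x - psiH h' w (consF a 𝔟) y‖ ≤ η := by
              rw [mul_add] at k3
              linarith
            have k6 := (huc (consF a 𝔞) (consF a 𝔟) (fun i hi => k0 i
              (lt_of_lt_of_le hi (le_max_left _ _))) _ hu _ hu' k5).2
            have k7 := (abs_le.1 k6).2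
            have k8 := mul_le_mul_of_nonneg_left (H.plo (consF a 𝔟) _ hu') (by linarith : 0 ≤ R - 1)
            linarith
          · have e1 : min w.length q0 + (q1 - (j + 1)) = min (w.length + 1) q0 + (q1 - j) := by
              omega
            rw [e1, pow_succ']
            apply le_of_eq
            ring
  have hlow : ∀ h, Near f δ h → ∀ (w : List A) (𝔞 : ℕ → A), ∀ x ∈ cube N, ∀ y ∈ cube N,
      PhiH φ h w 𝔞 x * ν (x - y) ≤ G ^ (min w.length q0) * R ^ w.length *
        ν (psiH h w 𝔞 x - psiH h w 𝔞 y) := by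
    intro h hh w
    induction w with
    | nil =>
      intro 𝔞 x _ y _
      simp [PhiH, psiH]
    | cons a w ih =>
      intro 𝔞 x hx y hy
      have h1 := ih (consF a 𝔞) x hx y hy
      have hu := psiH_mem hh.maps w (consF a 𝔞) hx
      have hu' := psiH_mem hh.maps w (consF a 𝔞) hy
      have hk0 := (hcontr h hh).psi_up w (consF a 𝔞) hx hy
      simp only [PhiH, psiH, Function.comp_apply, List.length_cons]
      set u := psiH h w (consF a 𝔞) x
      set u' := psiH h w (consF a 𝔞) y
      have hφ : 0 < φ (consF a 𝔞) u := lt_of_lt_of_le hg0 (H.plo _ _ hu)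
      have hn1 : 0 ≤ ν (u - u') := nrmK_nonneg κ _
      have hn2 : 0 ≤ ν (h (consF a 𝔞) u - h (consF a 𝔞) u') := nrmK_nonneg κ _
      have hs := (hst h (hNear h hh) (consF a 𝔞) u hu).1 u' hu'
      have hgen : ∀ s : ℝ, φ (consF a 𝔞) u * ν (u - u') ≤
          s * ν (h (consF a 𝔞) u - h (consF a 𝔞) u') →
          G ^ (min w.length q0) * R ^ w.length * s ≤
            G ^ (min (w.length + 1) q0) * R ^ (w.length + 1) →
          φ (consF a 𝔞) u * PhiH φ h w (consF a 𝔞) x * ν (x - y) ≤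
          G ^ (min (w.length + 1) q0) * R ^ (w.length + 1) *
            ν (h (consF a 𝔞) u - h (consF a 𝔞) u') := by
        intro s hs1 hs2
        calc _ = φ (consF a 𝔞) u * (PhiH φ h w (consF a 𝔞) x * ν (x - y)) := by ring
          _ ≤ φ (consF a 𝔞) u * (G ^ (min w.length q0) * R ^ w.length * ν (u - u')) :=
            mul_le_mul_of_nonneg_left h1 hφ.le
          _ = G ^ (min w.length q0) * R ^ w.length * (φ (consF a 𝔞) u * ν (u - u')) := by ring
          _ ≤ G ^ (min w.length q0) * R ^ w.length *
              (s * ν (h (consF a 𝔞) u - h (consF a 𝔞) u')) :=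
            mul_le_mul_of_nonneg_left hs1 (by positivity)
          _ = G ^ (min w.length q0) * R ^ w.length * s *
              ν (h (consF a 𝔞) u - h (consF a 𝔞) u') := by ring
          _ ≤ _ := mul_le_mul_of_nonneg_right hs2 hn2
      by_cases hw : w.length < q0
      · refine hgen G ?_ ?_
        · have k1 := mul_le_mul_of_nonneg_left hs.1 hG0.le
          have k2 : G * (γ0 * ν (u - u')) = γ * ν (u - u') := by
            rw [hG, hγ0]; field_simp
          have k3 := mul_le_mul_of_nonneg_right (H.phi (consF a 𝔞) _ hu) hn1
          linarith
        · have e1 : min (w.length + 1) q0 = min w.length q0 + 1 := by omega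
          have hRR : R ^ w.length ≤ R ^ (w.length + 1) := pow_le_pow_right₀ hR.le (by omega)
          rw [e1, pow_succ']
          calc _ = G * G ^ (min w.length q0) * R ^ w.length := by ring
            _ ≤ _ := mul_le_mul_of_nonneg_left hRR (by positivity)
      · push Not at hw
        refine hgen R (hs.2.2 ?_) ?_
        · have k1 := hne.norm_le (u - u')
          have k2 := (hne.le_norm (x - y)).trans (hDD x hx y hy)
          have k3 := mul_le_mul_of_nonneg_left k2 (pow_nonneg hγ10 w.length)
          have k4 := mul_le_mul_of_nonneg_left (hk0.trans k3) hc0.le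
          have k5 := hq0b _ hw
          linarith
        · have e1 : min (w.length + 1) q0 = min w.length q0 := by omega
          rw [e1, pow_succ]
          apply le_of_eq
          ring
  have hder : ∀ h, Near f δ h → ∀ (w : List A) (𝔞 : ℕ → A), ∀ x ∈ cube N, ∀ v,
      PhiH φ h w 𝔞 x * ν v ≤ R ^ w.length * ν (fderiv ℝ (psiH h w 𝔞) x v) ∧
      ν (fderiv ℝ (psiH h w 𝔞) x v) ≤ R ^ w.length * PhiH φ h w 𝔞 x * ν v := by
    intro h hh w
    induction w with
    | nil =>
      intro 𝔞 x _ v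
      simp [PhiH, psiH]
    | cons a w ih =>
      intro 𝔞 x hx v
      have h1 := ih (consF a 𝔞) x hx v
      have hu := psiH_mem hh.maps w (consF a 𝔞) hx
      have hfd : fderiv ℝ (psiH h (a :: w) 𝔞) x v =
          fderiv ℝ (h (consF a 𝔞)) (psiH h w (consF a 𝔞) x)
            (fderiv ℝ (psiH h w (consF a 𝔞)) x v) := by
        have := fderiv_comp x (hh.diff (consF a 𝔞) _ hu)
          (psiH_diff hh.maps hh.diff w (consF a 𝔞) hx)
        simp only [psiH]
        rw [this]
        rfl
      rw [hfd]
      simp only [PhiH, List.length_cons, pow_succ']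
      set u := psiH h w (consF a 𝔞) x
      set v' := fderiv ℝ (psiH h w (consF a 𝔞)) x v
      have hs := (hst h (hNear h hh) (consF a 𝔞) u hu).2 v'
      have hφ : 0 < φ (consF a 𝔞) u := lt_of_lt_of_le hg0 (H.plo _ _ hu)
      constructor
      · calc _ = φ (consF a 𝔞) u * (PhiH φ h w (consF a 𝔞) x * ν v) := by ring
          _ ≤ φ (consF a 𝔞) u * (R ^ w.length * ν v') := mul_le_mul_of_nonneg_left h1.1 hφ.le
          _ = R ^ w.length * (φ (consF a 𝔞) u * ν v') := by ring
          _ ≤ R ^ w.length * (R * ν _) := mul_le_mul_of_nonneg_left hs.1 (by positivity)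
          _ = _ := by ring
      · calc _ ≤ _ := hs.2
          _ ≤ R * φ (consF a 𝔞) u * (R ^ w.length * PhiH φ h w (consF a 𝔞) x * ν v) :=
            mul_le_mul_of_nonneg_left h1.2 (by positivity)
          _ = _ := by ring
  refine ⟨ν, c, γ0, γ1, δ, G ^ (q0 + q1), hδ, one_le_pow₀ hG1, by rw [hγ0]; linarith, hcontr,
    ?_, ?_, fun h hh w 𝔞 x hx v => (hder h hh w 𝔞 x hx v).1,
    fun h hh w 𝔞 x hx v => (hder h hh w 𝔞 x hx v).2⟩
  · intro h h' hh hh' w 𝔞 𝔟 x hx y hy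
    refine (hratio h h' hh hh' w 0 𝔞 𝔟 (by simp) x hx y hy).trans ?_
    refine mul_le_mul_of_nonneg_right ?_ (PhiH_pos H hh'.maps w 𝔟 hy).le
    refine mul_le_mul_of_nonneg_right (pow_le_pow_right₀ hG1 (by omega)) (by positivity)
  · intro h hh w 𝔞 x hx y hy
    refine (hlow h hh w 𝔞 x hx y hy).trans ?_
    refine mul_le_mul_of_nonneg_right ?_ (nrmK_nonneg κ _)
    refine mul_le_mul_of_nonneg_right (pow_le_pow_right₀ hG1 (by omega)) (by positivity)

/-! ### The pressure -/

def PhiBar (φ : (ℕ → A) → E N → ℝ) (f : (ℕ → A) → E N → E N) (w : List A) : ℝ :=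
  ⨆ z : (ℕ → A) × cube N, PhiH φ f w z.1 z.2

section pressure
variable {f : (ℕ → A) → E N → E N} {φ : (ℕ → A) → E N → ℝ} {γ' γ B : ℝ}

lemma PhiBar_bdd (H : Base f φ γ' γ B) (w : List A) :
    BddAbove (range fun z : (ℕ → A) × cube N => PhiH φ f w z.1 z.2) := by
  refine ⟨γ ^ w.length, ?_⟩
  rintro _ ⟨z, rfl⟩
  exact (PhiH_bounds H H.maps w z.1 z.2.2).2

lemma le_PhiBar (H : Base f φ γ' γ B) (w : List A) (𝔞 : ℕ → A) {x : E N} (hx : x ∈ cube N) :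
    PhiH φ f w 𝔞 x ≤ PhiBar φ f w :=
  le_ciSup (PhiBar_bdd H w) (⟨𝔞, ⟨x, hx⟩⟩ : (ℕ → A) × cube N)

lemma PhiBar_le [Nonempty A] {w : List A} {M : ℝ}
    (h : ∀ 𝔞, ∀ x ∈ cube N, PhiH φ f w 𝔞 x ≤ M) : PhiBar φ f w ≤ M := by
  have : Nonempty (cube N) := ⟨⟨0, zero_mem_cube N⟩⟩
  exact ciSup_le fun z => h z.1 z.2 z.2.2

lemma PhiBar_ge [Nonempty A] (H : Base f φ γ' γ B) (w : List A) :
    γ' ^ w.length ≤ PhiBar φ f w := by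
  obtain ⟨a⟩ := ‹Nonempty A›
  exact (PhiH_bounds H H.maps w (fun _ => a) (zero_mem_cube N)).1.trans
    (le_PhiBar H w _ (zero_mem_cube N))

lemma PhiBar_pos [Nonempty A] (H : Base f φ γ' γ B) (w : List A) : 0 < PhiBar φ f w :=
  lt_of_lt_of_le (pow_pos H.g0 _) (PhiBar_ge H w)

lemma PhiBar_up [Nonempty A] (H : Base f φ γ' γ B) (w : List A) :
    PhiBar φ f w ≤ γ ^ w.length :=
  PhiBar_le fun 𝔞 _ hx => (PhiH_bounds H H.maps w 𝔞 hx).2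

lemma PhiBar_append [Nonempty A] (H : Base f φ γ' γ B) (w v : List A) :
    PhiBar φ f (w ++ v) ≤ PhiBar φ f w * PhiBar φ f v := by
  refine PhiBar_le fun 𝔞 x hx => ?_
  rw [PhiH_append]
  exact mul_le_mul (le_PhiBar H w _ (psiH_mem H.maps v _ hx)) (le_PhiBar H v _ hx)
    (PhiH_pos H H.maps v _ hx).le (PhiBar_pos H w).le

def TT [Fintype A] (φ : (ℕ → A) → E N → ℝ) (f : (ℕ → A) → E N → E N) (s : ℝ) (n : ℕ) : ℝ :=
  ∑ w : Fin n → A, PhiBar φ f (List.ofFn w) ^ s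

lemma TT_pos [Fintype A] [Nonempty A] (H : Base f φ γ' γ B) (s : ℝ) (n : ℕ) :
    0 < TT φ f s n :=
  Finset.sum_pos (fun _ _ => Real.rpow_pos_of_pos (PhiBar_pos H _) _) Finset.univ_nonempty

lemma TT_add [Fintype A] [Nonempty A] (H : Base f φ γ' γ B) {s : ℝ} (hs : 0 ≤ s) (m n : ℕ) :
    TT φ f s (m + n) ≤ TT φ f s m * TT φ f s n := by
  rw [TT, TT, TT, Finset.sum_mul_sum, ← Finset.sum_product', Finset.univ_product_univ,
    ← (Fin.appendEquiv m n).sum_comp]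
  refine Finset.sum_le_sum fun z _ => ?_
  rw [← Real.mul_rpow (PhiBar_pos H _).le (PhiBar_pos H _).le]
  refine Real.rpow_le_rpow (PhiBar_pos H _).le ?_ hs
  have : List.ofFn (Fin.appendEquiv m n z) = List.ofFn z.1 ++ List.ofFn z.2 := by
    rw [← List.ofFn_fin_append]
    rfl
  rw [this]
  exact PhiBar_append H _ _

lemma TT_subadd [Fintype A] [Nonempty A] (H : Base f φ γ' γ B) {s : ℝ} (hs : 0 ≤ s) :
    Subadditive fun n => Real.log (TT φ f s n) := by
  intro m n
  rw [← Real.log_mul (TT_pos H s m).ne' (TT_pos H s n).ne']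
  exact Real.log_le_log (TT_pos H s _) (TT_add H hs m n)

lemma TT_bdd [Fintype A] [Nonempty A] (H : Base f φ γ' γ B) {s : ℝ} (hs : 0 ≤ s) :
    BddBelow (range fun n : ℕ => Real.log (TT φ f s n) / n) := by
  refine ⟨min 0 (s * Real.log γ'), ?_⟩
  rintro _ ⟨n, rfl⟩
  rcases Nat.eq_zero_or_pos n with rfl | hn
  · simp
  · refine (min_le_right _ _).trans ?_
    have hn' : (0:ℝ) < n := by exact_mod_cast hn
    show s * Real.log γ' ≤ Real.log (TT φ f s n) / n
    rw [le_div_iff₀ hn']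
    obtain ⟨a⟩ := ‹Nonempty A›
    have h1 : (γ' ^ n) ^ s ≤ TT φ f s n := by
      have h2 : PhiBar φ f (List.ofFn fun _ : Fin n => a) ^ s ≤ TT φ f s n :=
        Finset.single_le_sum (f := fun w : Fin n → A => PhiBar φ f (List.ofFn w) ^ s)
          (fun w _ => Real.rpow_nonneg (have : Nonempty A := ⟨a⟩; PhiBar_pos H _).le _)
          (Finset.mem_univ _)
      refine le_trans (Real.rpow_le_rpow (pow_pos H.g0 _).le ?_ hs) h2
      have : Nonempty A := ⟨a⟩
      simpa using PhiBar_ge H (List.ofFn fun _ : Fin n => a)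
    have h3 := Real.log_le_log (Real.rpow_pos_of_pos (pow_pos H.g0 n) s) h1
    rw [Real.log_rpow (pow_pos H.g0 n), Real.log_pow] at h3
    linarith

lemma Mop_compare [Nonempty A] (hN : 0 < N) (H : Base f φ γ' γ B) {R : ℝ} (hR : 1 < R) :
    ∃ K : ℝ, 1 ≤ K ∧ ∀ (w : List A) (𝔞 : ℕ → A),
      PhiBar φ f w ≤ K * R ^ (2 * w.length) * Mop (psiH f w 𝔞) ∧
      Mop (psiH f w 𝔞) ≤ K * R ^ (2 * w.length) * PhiBar φ f w := by
  obtain ⟨ν, c, γ0, γ1, δ, K, HD⟩ := exists_distort H hR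
  have hnear := H.near HD.δpos.le
  have hC := HD.contr f hnear
  have hc := hC.ne.c_pos
  have hK := HD.Kone
  have hR0 : 0 < R := by linarith
  have hc1 : 1 ≤ c := by
    have h1 := hC.ne.norm_le (EuclideanSpace.single (⟨0, hN⟩ : Fin N) (1:ℝ))
    have h2 := hC.ne.le_norm (EuclideanSpace.single (⟨0, hN⟩ : Fin N) (1:ℝ))
    have h3 : ‖(EuclideanSpace.single (⟨0, hN⟩ : Fin N) (1:ℝ))‖ = 1 := by simp
    rw [h3] at h1 h2
    nlinarith
  have hcK : 1 ≤ c * K := one_le_mul_of_one_le_of_one_le hc1 hK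
  refine ⟨c * K, hcK, fun w 𝔞 => ?_⟩
  have hbd : ∀ x ∈ cube N, ‖fderiv ℝ (psiH f w 𝔞) x‖ ≤ c * R ^ w.length * PhiBar φ f w := by
    intro x hx
    have hPb := PhiBar_pos H w
    refine ContinuousLinearMap.opNorm_le_bound _ (by positivity) fun v => ?_
    have h1 := hC.ne.norm_le (fderiv ℝ (psiH f w 𝔞) x v)
    have h2 := HD.dup f hnear w 𝔞 x hx v
    have h3 := le_PhiBar H w 𝔞 hx
    have h4 := hC.ne.le_norm v
    have h5 := hC.ne.nonneg v
    have h6 : R ^ w.length * PhiH φ f w 𝔞 x * ν v ≤ R ^ w.length * PhiBar φ f w * ‖v‖ :=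
      mul_le_mul (mul_le_mul_of_nonneg_left h3 (by positivity)) h4 h5 (by positivity)
    have h7 := mul_le_mul_of_nonneg_left (h2.trans h6) hc.le
    calc _ ≤ _ := h1
      _ ≤ _ := h7
      _ = _ := by ring
  have hbdd : BddAbove ((fun x => ‖fderiv ℝ (psiH f w 𝔞) x‖) '' cube N) := by
    refine ⟨c * R ^ w.length * PhiBar φ f w, ?_⟩
    rintro _ ⟨x, hx, rfl⟩
    exact hbd x hx
  have hRR : R ^ w.length ≤ R ^ (2 * w.length) := pow_le_pow_right₀ hR.le (by omega)
  constructor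
  · have h0 : ‖fderiv ℝ (psiH f w 𝔞) 0‖ ≤ Mop (psiH f w 𝔞) :=
      le_csSup hbdd ⟨0, zero_mem_cube N, rfl⟩
    set v : E N := EuclideanSpace.single (⟨0, hN⟩ : Fin N) (1:ℝ) with hv
    have hv1 : ‖v‖ = 1 := by simp [hv]
    have h1 := HD.dlow f hnear w 𝔞 0 (zero_mem_cube N) v
    have h2 := hC.ne.le_norm (fderiv ℝ (psiH f w 𝔞) 0 v)
    have h3 := (fderiv ℝ (psiH f w 𝔞) 0).le_opNorm v
    rw [hv1, mul_one] at h3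
    have h4 := hC.ne.norm_le v
    rw [hv1] at h4
    have hP := PhiH_pos H H.maps w 𝔞 (zero_mem_cube N)
    have h5 : PhiH φ f w 𝔞 0 ≤ c * (R ^ w.length * Mop (psiH f w 𝔞)) := by
      calc PhiH φ f w 𝔞 0 = PhiH φ f w 𝔞 0 * 1 := by ring
        _ ≤ PhiH φ f w 𝔞 0 * (c * ν v) := mul_le_mul_of_nonneg_left h4 hP.le
        _ = c * (PhiH φ f w 𝔞 0 * ν v) := by ring
        _ ≤ c * (R ^ w.length * ν (fderiv ℝ (psiH f w 𝔞) 0 v)) :=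
          mul_le_mul_of_nonneg_left h1 hc.le
        _ ≤ _ := by
          refine mul_le_mul_of_nonneg_left ?_ hc.le
          exact mul_le_mul_of_nonneg_left (h2.trans (h3.trans h0)) (by positivity)
    refine PhiBar_le fun 𝔟 x hx => ?_
    have h6 := HD.ratio f f hnear hnear w 𝔟 𝔞 x hx 0 (zero_mem_cube N)
    calc _ ≤ _ := h6
      _ ≤ K * R ^ w.length * (c * (R ^ w.length * Mop (psiH f w 𝔞))) :=
        mul_le_mul_of_nonneg_left h5 (by positivity)
      _ = _ := by
        rw [two_mul, pow_add]
        ring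
  · have hPb := PhiBar_pos H w
    refine csSup_le ⟨_, 0, zero_mem_cube N, rfl⟩ ?_
    rintro _ ⟨x, hx, rfl⟩
    refine (hbd x hx).trans (mul_le_mul_of_nonneg_right ?_ hPb.le)
    refine mul_le_mul ?_ hRR (by positivity) (by positivity)
    nlinarith

lemma TT_ge_one [Fintype A] [Nonempty A] (hN : 0 < N) (H : Base f φ γ' γ B) {s : ℝ}
    (hs : 0 ≤ s) (𝔞 : ℕ → A)
    (hp : limUnder atTop (fun n : ℕ => (1 / n : ℝ) * Real.log
      (∑ w : Fin n → A, Mop (psiH f (List.ofFn w) 𝔞) ^ s)) = 0) (n : ℕ) (hn : n ≠ 0) :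
    1 ≤ TT φ f s n := by
  have hsub := TT_subadd H hs
  have hbdd := TT_bdd H hs
  have hlim := hsub.tendsto_lim hbdd
  set Z : ℕ → ℝ := fun n => ∑ w : Fin n → A, Mop (psiH f (List.ofFn w) 𝔞) ^ s with hZ
  have hest : ∀ R > (1:ℝ), ∃ K : ℝ, 1 ≤ K ∧ ∀ n : ℕ,
      |Real.log (Z n) - Real.log (TT φ f s n)| ≤ s * Real.log K + 2 * s * n * Real.log R := by
    intro R hR
    have hR0 : 0 < R := by linarith
    obtain ⟨K, hK, hcmp⟩ := Mop_compare hN H hR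
    refine ⟨K, hK, fun n => ?_⟩
    have hQ : 0 < K * R ^ (2 * n) := by positivity
    have hT := TT_pos H s n
    have hMop : ∀ w : Fin n → A, 0 ≤ Mop (psiH f (List.ofFn w) 𝔞) := by
      intro w
      have h1 := (hcmp (List.ofFn w) 𝔞).1
      rw [List.length_ofFn] at h1
      by_contra hneg
      push Not at hneg
      have := PhiBar_pos H (List.ofFn w)
      nlinarith
    have h1 : TT φ f s n ≤ (K * R ^ (2 * n)) ^ s * Z n := by
      rw [TT, hZ, Finset.mul_sum]
      refine Finset.sum_le_sum fun w _ => ?_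
      rw [← Real.mul_rpow hQ.le (hMop w)]
      refine Real.rpow_le_rpow (PhiBar_pos H _).le ?_ hs
      have h1 := (hcmp (List.ofFn w) 𝔞).1
      rwa [List.length_ofFn] at h1
    have h2 : Z n ≤ (K * R ^ (2 * n)) ^ s * TT φ f s n := by
      rw [TT, hZ, Finset.mul_sum]
      refine Finset.sum_le_sum fun w _ => ?_
      rw [← Real.mul_rpow hQ.le (PhiBar_pos H _).le]
      refine Real.rpow_le_rpow (hMop w) ?_ hs
      have h1 := (hcmp (List.ofFn w) 𝔞).2
      rwa [List.length_ofFn] at h1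
    have hQs : 0 < (K * R ^ (2 * n)) ^ s := Real.rpow_pos_of_pos hQ s
    have hZp : 0 < Z n := by
      by_contra hneg
      push Not at hneg
      have := mul_nonpos_of_nonneg_of_nonpos hQs.le hneg
      linarith
    have h3 := Real.log_le_log hT h1
    have h4 := Real.log_le_log hZp h2
    rw [Real.log_mul hQs.ne' hZp.ne', Real.log_rpow hQ, Real.log_mul (by positivity)
      (by positivity), Real.log_pow] at h3
    rw [Real.log_mul hQs.ne' hT.ne', Real.log_rpow hQ, Real.log_mul (by positivity)
      (by positivity), Real.log_pow] at h4
    push_cast at h3 h4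
    rw [abs_le]
    constructor <;> nlinarith
  have hdiff : Tendsto (fun n : ℕ => (1 / n : ℝ) * Real.log (Z n) -
      Real.log (TT φ f s n) / n) atTop (𝓝 0) := by
    rw [Metric.tendsto_nhds]
    intro ε hε
    obtain ⟨K, hK, hKK⟩ := hest (Real.exp (ε / (4 * (s + 1)))) (by
      rw [gt_iff_lt, Real.one_lt_exp_iff]
      positivity)
    rw [Real.log_exp] at hKK
    have h1 : Tendsto (fun n : ℕ => s * Real.log K / (n:ℝ)) atTop (𝓝 0) :=
      tendsto_const_div_atTop_nhds_zero_nat _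
    filter_upwards [h1.eventually (gt_mem_nhds (half_pos hε)), eventually_gt_atTop 0] with n hn hn0
    have hn' : (0:ℝ) < n := by exact_mod_cast hn0
    rw [Real.dist_eq, sub_zero]
    have h2 : (1 / n : ℝ) * Real.log (Z n) - Real.log (TT φ f s n) / n =
        (Real.log (Z n) - Real.log (TT φ f s n)) / n := by ring
    rw [h2, abs_div, abs_of_pos hn', div_lt_iff₀ hn']
    rw [div_lt_iff₀ hn'] at hn
    refine lt_of_le_of_lt (hKK n) ?_
    have h3 : 2 * s * (ε / (4 * (s + 1))) ≤ ε / 2 := by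
      rw [← mul_div_assoc, div_le_iff₀ (by positivity)]
      nlinarith
    nlinarith
  have hZlim : Tendsto (fun n : ℕ => (1 / n : ℝ) * Real.log (Z n)) atTop (𝓝 hsub.lim) := by
    have := hdiff.add hlim
    simpa using this
  have hL : hsub.lim = 0 := by rw [← hZlim.limUnder_eq]; exact hp
  have h5 := hsub.lim_le_div hbdd hn
  rw [hL] at h5
  have hn' : (0:ℝ) < n := by exact_mod_cast Nat.pos_of_ne_zero hn
  have h6 : 0 ≤ Real.log (TT φ f s n) := by
    by_contra hneg
    push Not at hneg
    have := div_neg_of_neg_of_pos hneg hn'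
    linarith
  by_contra hneg
  push Not at hneg
  have := Real.log_neg (TT_pos H s n) hneg
  linarith

theorem block_of_pressure [Fintype A] [Nonempty A] (hN : 0 < N) (H : Base f φ γ' γ B) {s : ℝ}
    (hs : (N:ℝ) < s) (𝔞 : ℕ → A)
    (hp : limUnder atTop (fun n : ℕ => (1 / n : ℝ) * Real.log
      (∑ w : Fin n → A, Mop (psiH f (List.ofFn w) 𝔞) ^ s)) = 0) :
    ∃ (ν : E N → ℝ) (c γ0 γ1 δ : ℝ), 0 < c ∧ 0 < γ0 ∧ γ0 ≤ 1 ∧ 0 < δ ∧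
      ∃ (n : ℕ) (mb : (Fin n → A) → ℝ), (∀ b, 0 < mb b) ∧ (∀ b, mb b ≤ 1) ∧
        1 < ∑ b, mb b ^ N ∧ ∀ h, Near f δ h → Contr ν c γ0 γ1 h ∧
          ∀ (b : Fin n → A) (𝔞 : ℕ → A), ∀ x ∈ cube N, ∀ y ∈ cube N, mb b * ν (x - y) ≤
            ν (psiH h (List.ofFn b) 𝔞 x - psiH h (List.ofFn b) 𝔞 y) := by
  have hN0 : (0:ℝ) ≤ N := Nat.cast_nonneg N
  have hs0 : 0 ≤ s := by linarith
  have hg0 : 0 < γ := lt_of_lt_of_le H.g0 H.gg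
  have hlγ : Real.log γ < 0 := Real.log_neg hg0 H.g1
  set E0 : ℝ := (s - N) * (-Real.log γ) with hE0
  have hE0p : 0 < E0 := mul_pos (by linarith) (by linarith)
  set t : ℝ := E0 / (2 * N + 1) with ht
  have htp : 0 < t := by positivity
  have hR : 1 < Real.exp t := by rwa [Real.one_lt_exp_iff]
  set R := Real.exp t with hRdef
  have hR0 : 0 < R := by linarith
  obtain ⟨ν, c, γ0, γ1, δ, K, HD⟩ := exists_distort H hR
  have hC := HD.contr f (H.near HD.δpos.le)
  have hK := HD.Kone
  have hK0 : 0 < K := by linarith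
  -- growth rate
  have hρ : 1 < Real.exp t := hR
  obtain ⟨n, hn⟩ := ((tendsto_pow_atTop_atTop_of_one_lt hρ).eventually
    (eventually_gt_atTop ((K ^ 2) ^ N))).and (eventually_ge_atTop 1) |>.exists
  obtain ⟨hn1, hn2⟩ := hn
  have hQ : 0 < K ^ 2 * R ^ (2 * n) := by positivity
  have hQ1 : 1 ≤ K ^ 2 * R ^ (2 * n) :=
    one_le_mul_of_one_le_of_one_le (one_le_pow₀ hK) (one_le_pow₀ hR.le)
  have hT := TT_ge_one hN H hs0 𝔞 hp n (by omega)
  refine ⟨ν, c, γ0, γ1, δ, hC.ne.c_pos, hC.g0, HD.g0one, HD.δpos, n,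
    fun b => PhiBar φ f (List.ofFn b) / (K ^ 2 * R ^ (2 * n)),
    fun b => div_pos (PhiBar_pos H _) hQ, fun b => ?_, ?_, fun h hh => ⟨HD.contr h hh, ?_⟩⟩
  · rw [div_le_one hQ]
    refine ((PhiBar_up H _).trans (pow_le_one₀ hg0.le H.g1.le)).trans hQ1
  · have h1 : ∀ b : Fin n → A, PhiBar φ f (List.ofFn b) ^ s ≤
        Real.exp (-(n * E0)) * PhiBar φ f (List.ofFn b) ^ N := by
      intro b
      have hP := PhiBar_pos H (List.ofFn b)
      have h2 : PhiBar φ f (List.ofFn b) ^ s =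
          PhiBar φ f (List.ofFn b) ^ (s - N) * PhiBar φ f (List.ofFn b) ^ N := by
        rw [← Real.rpow_natCast, ← Real.rpow_add hP]
        congr 1
        ring
      rw [h2]
      refine mul_le_mul_of_nonneg_right ?_ (by positivity)
      have h3 := PhiBar_up H (List.ofFn b)
      rw [List.length_ofFn] at h3
      refine (Real.rpow_le_rpow hP.le h3 (by linarith)).trans (le_of_eq ?_)
      rw [Real.rpow_def_of_pos (by positivity), Real.log_pow]
      congr 1
      rw [hE0]
      ring
    have h2 : 1 ≤ Real.exp (-(n * E0)) * ∑ b : Fin n → A, PhiBar φ f (List.ofFn b) ^ N := by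
      refine hT.trans ?_
      rw [TT, Finset.mul_sum]
      exact Finset.sum_le_sum fun b _ => h1 b
    have h3 : Real.exp (n * E0) ≤ ∑ b : Fin n → A, PhiBar φ f (List.ofFn b) ^ N := by
      have := mul_le_mul_of_nonneg_left h2 (Real.exp_pos (n * E0)).le
      rwa [← mul_assoc (Real.exp (n * E0)) (Real.exp (-(n * E0))), ← Real.exp_add, add_neg_cancel, Real.exp_zero, one_mul, mul_one] at this
    simp only [div_pow]
    rw [← Finset.sum_div, one_lt_div (by positivity)]
    refine lt_of_lt_of_le ?_ h3
    have h4 : Real.exp (n * E0) = (R ^ (2 * n)) ^ N * Real.exp t ^ n := by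
      rw [hRdef, ← Real.exp_nat_mul, ← Real.exp_nat_mul, ← Real.exp_nat_mul, ← Real.exp_add]
      congr 1
      have : E0 = t * (2 * N + 1) := by rw [ht]; field_simp
      rw [this]
      push_cast
      ring
    rw [h4, mul_pow, mul_comm]
    exact mul_lt_mul_of_pos_left hn1 (by positivity)
  · intro b 𝔟 x hx y hy
    have h1 := HD.low h hh (List.ofFn b) 𝔟 x hx y hy
    have h2 : PhiBar φ f (List.ofFn b) ≤ K * R ^ n * PhiH φ h (List.ofFn b) 𝔟 x := by
      refine PhiBar_le fun 𝔠 z hz => ?_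
      have := HD.ratio f h (H.near HD.δpos.le) hh (List.ofFn b) 𝔠 𝔟 z hz x hx
      rwa [List.length_ofFn] at this
    rw [List.length_ofFn] at h1
    rw [div_mul_eq_mul_div, div_le_iff₀ hQ]
    have h3 := hC.ne.nonneg (x - y)
    calc _ ≤ K * R ^ n * PhiH φ h (List.ofFn b) 𝔟 x * ν (x - y) :=
          mul_le_mul_of_nonneg_right h2 h3
      _ = K * R ^ n * (PhiH φ h (List.ofFn b) 𝔟 x * ν (x - y)) := by ring
      _ ≤ K * R ^ n * _ := mul_le_mul_of_nonneg_left h1 (by positivity)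
      _ = _ := by
        rw [two_mul, pow_add]
        ring

end pressure

/-! ### Uniform continuity of the family and perturbations -/

lemma ucont [Fintype A] [Nonempty A] {V : Type} [NormedAddCommGroup V]
    {Kp : Set (E d)} (hKp : IsCompact Kp) (G : E d → (ℕ → A) → E N → V)
    (hcont : ∀ 𝔞, ContinuousOn (fun q : E d × E N => G q.1 𝔞 q.2) (Kp ×ˢ cube N))
    {C θ : ℝ} (hC : 0 < C) (hθ : θ ∈ Ioo (0:ℝ) 1)
    (hhol : ∀ p ∈ Kp, ∀ (𝔞 𝔟 : ℕ → A) (q : ℕ), (∀ i < q, 𝔞 i = 𝔟 i) → ∀ x ∈ cube N,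
      ‖G p 𝔞 x - G p 𝔟 x‖ ≤ C * θ ^ q) :
    (∃ B ≥ (0:ℝ), ∀ p ∈ Kp, ∀ 𝔞, ∀ x ∈ cube N, ‖G p 𝔞 x‖ ≤ B) ∧
    ∀ ε > (0:ℝ), ∃ η > (0:ℝ), ∃ q : ℕ, ∀ p ∈ Kp, ∀ p' ∈ Kp, ∀ 𝔞 𝔟 : ℕ → A,
      (∀ i < q, 𝔞 i = 𝔟 i) → ∀ x ∈ cube N, ∀ y ∈ cube N, ‖p - p'‖ ≤ η → ‖x - y‖ ≤ η →
      ‖G p 𝔞 x - G p' 𝔟 y‖ ≤ ε := by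
  obtain ⟨a0⟩ := ‹Nonempty A›
  have hcpt : IsCompact (Kp ×ˢ cube N) := hKp.prod (isCompact_cube N)
  constructor
  · obtain ⟨M, hM⟩ := hcpt.exists_bound_of_continuousOn (hcont fun _ => a0)
    refine ⟨|M| + C, by positivity, fun p hp 𝔞 x hx => ?_⟩
    have h1 := hM (p, x) ⟨hp, hx⟩
    have h2 := hhol p hp 𝔞 (fun _ => a0) 0 (by simp) x hx
    rw [pow_zero, mul_one] at h2
    have h3 := norm_sub_norm_le (G p 𝔞 x) (G p (fun _ => a0) x)
    have h4 := le_abs_self M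
    simp only at h1
    linarith
  · intro ε hε
    have ht : Tendsto (fun q : ℕ => C * θ ^ q) atTop (𝓝 0) := by
      simpa using (tendsto_pow_atTop_nhds_zero_of_lt_one hθ.1.le hθ.2).const_mul C
    obtain ⟨q, hq⟩ := (ht.eventually (gt_mem_nhds (by positivity : 0 < ε / 3))).exists
    let rep : (Fin q → A) → ℕ → A := fun b i => if hi : i < q then b ⟨i, hi⟩ else a0
    have hrep : ContinuousOn (fun z : E d × E N => fun b : Fin q → A => G z.1 (rep b) z.2)
        (Kp ×ˢ cube N) := continuousOn_pi.2 fun b => hcont (rep b)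
    have huc := hcpt.uniformContinuousOn_of_continuous hrep
    rw [Metric.uniformContinuousOn_iff] at huc
    obtain ⟨η, hη, hη2⟩ := huc (ε / 3) (by positivity)
    refine ⟨η / 2, by positivity, q, fun p hp p' hp' 𝔞 𝔟 hab x hx y hy hpp hxy => ?_⟩
    set b : Fin q → A := fun i => 𝔞 i with hb
    have r1 : ∀ i < q, 𝔞 i = rep b i := fun i hi => by simp [rep, hi, hb]
    have r2 : ∀ i < q, rep b i = 𝔟 i := fun i hi => by rw [← r1 i hi, hab i hi]
    have h1 := hhol p hp _ _ q r1 x hx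
    have h2 := hhol p' hp' _ _ q r2 y hy
    have h3 := hη2 (p, x) ⟨hp, hx⟩ (p', y) ⟨hp', hy⟩ (by
      rw [Prod.dist_eq, dist_eq_norm, dist_eq_norm]
      exact max_lt (by simp only; linarith) (by simp only; linarith))
    have h4 := (dist_le_pi_dist _ _ b).trans h3.le
    rw [dist_eq_norm] at h4
    simp only at h4
    calc ‖G p 𝔞 x - G p' 𝔟 y‖ = ‖(G p 𝔞 x - G p (rep b) x) + (G p (rep b) x - G p' (rep b) y)
          + (G p' (rep b) y - G p' 𝔟 y)‖ := by congr 1; abel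
      _ ≤ _ := norm_add₃_le
      _ ≤ ε := by linarith

section pert
variable {r : ℕ∞}

lemma slice_fderiv {P' : Set (E d)} {X' : Set (E N)} (hP : IsOpen P') (hX : IsOpen X')
    (hr : 2 ≤ r) {F : E d × E N → E N} (hF : ContDiffOn ℝ r F (P' ×ˢ X')) {p : E d} {x : E N}
    (hp : p ∈ P') (hx : x ∈ X') : HasFDerivAt (fun y => F (p, y))
      ((fderiv ℝ F (p, x)).comp (ContinuousLinearMap.inr ℝ (E d) (E N))) x ∧
      DifferentiableAt ℝ F (p, x) := by
  have h0 : ((r : ℕ∞) : WithTop ℕ∞) ≠ 0 := by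
    intro h
    have h1 : r = 0 := by exact_mod_cast h
    rw [h1] at hr
    exact absurd hr (by norm_num)
  have h1 : DifferentiableAt ℝ F (p, x) :=
    (hF.contDiffAt ((hP.prod hX).mem_nhds ⟨hp, hx⟩)).differentiableAt h0
  exact ⟨h1.hasFDerivAt.comp x (hasFDerivAt_prodMk_right p x), h1⟩

lemma slice_cont {P' : Set (E d)} {X' : Set (E N)} (hP : IsOpen P') (hX : IsOpen X')
    (hr : 2 ≤ r) {F : E d × E N → E N} (hF : ContDiffOn ℝ r F (P' ×ˢ X')) :
    ContinuousOn (fun q : E d × E N => fderiv ℝ (fun y => F (q.1, y)) q.2) (P' ×ˢ X') := by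
  have h1 : (1 : WithTop ℕ∞) ≤ ((r : ℕ∞) : WithTop ℕ∞) := by
    have : (1 : ℕ∞) ≤ r := le_trans (by norm_num) hr
    exact_mod_cast this
  have h2 := hF.continuousOn_fderiv_of_isOpen (hP.prod hX) h1
  have h3 : ContinuousOn (fun q => (fderiv ℝ F q).comp (ContinuousLinearMap.inr ℝ (E d) (E N)))
      (P' ×ˢ X') := h2.clm_comp continuousOn_const
  refine h3.congr fun q hq => ?_
  exact (slice_fderiv hP hX hr hF hq.1 hq.2).1.fderiv

/-- Admissible perturbations (for the estimates). -/
structure Adm (S : SkewFamily A N d r) (θ : ℝ) (g : E d → (ℕ → A) → E N → E N) : Prop where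
  sm : ∀ 𝔞, ContDiffOn ℝ r (fun q : E d × E N => g q.1 𝔞 q.2) (S.P' ×ˢ S.X')
  into : ∀ 𝔞 : ℕ → A, ∀ p ∈ S.P', g p 𝔞 '' S.X' ⊆ cube N
  c0 : ∀ 𝔞, ∀ p ∈ S.P', ∀ x ∈ S.X', ‖S.f p 𝔞 x - g p 𝔞 x‖ ≤ θ
  c1 : ∀ 𝔞, ∀ p ∈ S.P', ∀ x ∈ S.X',
    ‖fderiv ℝ (fun q : E d × E N => S.f q.1 𝔞 q.2 - g q.1 𝔞 q.2) (p, x)‖ ≤ θ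

lemma Adm.mono {S : SkewFamily A N d r} {θ θ' : ℝ} {g : E d → (ℕ → A) → E N → E N}
    (H : Adm S θ g) (h : θ ≤ θ') : Adm S θ' g :=
  ⟨H.sm, H.into, fun a p hp x hx => (H.c0 a p hp x hx).trans h,
    fun a p hp x hx => (H.c1 a p hp x hx).trans h⟩

lemma adm_self (S : SkewFamily A N d r) {θ : ℝ} (hθ : 0 ≤ θ) : Adm S θ S.f := by
  refine ⟨S.smooth, S.into, fun a p hp x hx => by simpa using hθ, fun a p hp x hx => ?_⟩
  simpa using hθ

lemma adm_pert {hN : 0 < N} (hr : 2 ≤ r) {S : SkewFamily A N d r} {θ : ℝ} {τ : ℕ}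
    (Ft : ParamPerturb hN S θ τ) {t : E τ} (ht : t ∈ cubeO τ) : Adm S θ (Ft.g t) := by
  obtain ⟨θ', hθ', hcl⟩ := Ft.close
  refine ⟨Ft.smooth t ht, Ft.into t ht, fun a p hp x hx => ?_, fun a p hp x hx => ?_⟩
  · have := hcl t ht a 0 (by simp) p hp x hx
    rw [norm_iteratedFDeriv_zero] at this
    exact this.trans hθ'.le
  · have := hcl t ht a 1 (le_trans (by norm_num) hr) p hp x hx
    rw [norm_iteratedFDeriv_one] at this
    exact this.trans hθ'.le

lemma fam_data [Fintype A] [Nonempty A] (hN : 0 < N) (hr : 2 ≤ r) (S : SkewFamily A N d r)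
    (hU : UnipOn hN S.f S.P' S.X') (γ' γ : ℝ) (hγ : GammaBounds hN S.f γ' γ) :
    (∃ B, ∀ p ∈ closure (cubeO d), Base (S.f p)
      (fun 𝔞 x => |dentry (S.f p 𝔞) x ⟨0, hN⟩ ⟨0, hN⟩|) γ' γ B) ∧
    ∀ δ > (0:ℝ), ∃ η > (0:ℝ), ∀ p ∈ closure (cubeO d), ∀ p' ∈ closure (cubeO d),
      ‖p - p'‖ ≤ η → ∀ g, Adm S (δ / 2) g → Near (S.f p') δ (g p) := by
  obtain ⟨C0, hC0, θ0, hθ0, hh0⟩ := S.holder0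
  obtain ⟨C1, hC1, θ1, hθ1, hh1⟩ := S.holder1
  have hsub : closure (cubeO d) ×ˢ cube N ⊆ S.P' ×ˢ S.X' := prod_mono S.P_subset S.X_subset
  have U0 := ucont (isCompact_closure_cubeO d) S.f
    (fun 𝔞 => ((S.smooth 𝔞).continuousOn).mono hsub) hC0 hθ0
    (fun p hp 𝔞 𝔟 q hq x hx => hh0 p (S.P_subset hp) 𝔞 𝔟 q hq x (S.X_subset hx))
  have U1 := ucont (isCompact_closure_cubeO d) (fun p 𝔞 x => fderiv ℝ (S.f p 𝔞) x)
    (fun 𝔞 => (slice_cont S.P'_open S.X'_open hr (S.smooth 𝔞)).mono hsub) hC1 hθ1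
    (fun p hp 𝔞 𝔟 q hq x hx => hh1 p (S.P_subset hp) 𝔞 𝔟 q hq x (S.X_subset hx))
  obtain ⟨⟨B, hB, hBB⟩, hu1⟩ := U1
  obtain ⟨-, hu0⟩ := U0
  obtain ⟨g0, gg, g1, hlam⟩ := hγ
  have hlam' : ∀ p ∈ closure (cubeO d), ∀ 𝔞 : ℕ → A, ∀ x ∈ cube N,
      γ' < |dentry (S.f p 𝔞) x ⟨0, hN⟩ ⟨0, hN⟩| ∧ |dentry (S.f p 𝔞) x ⟨0, hN⟩ ⟨0, hN⟩| < γ := by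
    intro p hp 𝔞 x hx
    have h1 := hlam p hp (shiftF 𝔞) (𝔞 0) x hx
    simp only [lam, psi, consF_shiftF, Function.comp_id] at h1
    exact h1
  constructor
  · refine ⟨B, fun p hp => ?_⟩
    have hp' := S.P_subset hp
    refine ⟨g0, gg.le, g1, hB, fun 𝔞 x hx => S.into 𝔞 p hp' ⟨x, S.X_subset hx, rfl⟩,
      fun 𝔞 x hx => (slice_fderiv S.P'_open S.X'_open hr (S.smooth 𝔞) hp'
        (S.X_subset hx)).1.differentiableAt,
      fun 𝔞 x hx i j hij => (hU p hp' 𝔞 x (S.X_subset hx)).1 i j hij,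
      fun 𝔞 x hx i => by rw [(hU p hp' 𝔞 x (S.X_subset hx)).2.1 i ⟨0, hN⟩],
      fun 𝔞 x hx => (hlam' p hp 𝔞 x hx).1.le, fun 𝔞 x hx => (hlam' p hp 𝔞 x hx).2.le,
      fun 𝔞 x hx => hBB p hp 𝔞 x hx, fun ε hε => ?_⟩
    obtain ⟨η0, hη0, q0, H0⟩ := hu0 ε hε
    obtain ⟨η1, hη1, q1, H1⟩ := hu1 ε hε
    refine ⟨η1, hη1, max q0 q1, fun 𝔞 𝔟 hab x hx y hy hxy => ⟨?_, ?_⟩⟩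
    · exact H0 p hp p hp 𝔞 𝔟 (fun i hi => hab i (lt_of_lt_of_le hi (le_max_left _ _))) x hx x hx
        (by simpa using hη0.le) (by simpa using hη0.le)
    · have h1 := H1 p hp p hp 𝔞 𝔟 (fun i hi => hab i (lt_of_lt_of_le hi (le_max_right _ _)))
        x hx y hy (by simpa using hη1.le) hxy
      exact (abs_abs_sub_abs_le_abs_sub _ _).trans ((dentry_sub_abs_le _ _ _ _ _ _).trans h1)
  · intro δ hδ
    obtain ⟨η0, hη0, q0, H0⟩ := hu0 (δ / 2) (by positivity)
    obtain ⟨η1, hη1, q1, H1⟩ := hu1 (δ / 2) (by positivity)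
    refine ⟨min η0 η1, lt_min hη0 hη1, fun p hp p' hp' hpp g hg => ?_⟩
    have hpP := S.P_subset hp
    refine ⟨fun 𝔞 x hx => hg.into 𝔞 p hpP ⟨x, S.X_subset hx, rfl⟩,
      fun 𝔞 x hx => (slice_fderiv S.P'_open S.X'_open hr (hg.sm 𝔞) hpP
        (S.X_subset hx)).1.differentiableAt, fun 𝔞 x hx => ?_, fun 𝔞 x hx => ?_⟩
    · have h1 := hg.c0 𝔞 p hpP x (S.X_subset hx)
      have h2 := H0 p hp p' hp' 𝔞 𝔞 (fun _ _ => rfl) x hx x hx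
        (hpp.trans (min_le_left _ _)) (by simpa using hη0.le)
      rw [norm_sub_rev] at h1
      calc _ = ‖(g p 𝔞 x - S.f p 𝔞 x) + (S.f p 𝔞 x - S.f p' 𝔞 x)‖ := by congr 1; abel
        _ ≤ _ := norm_add_le _ _
        _ ≤ δ := by linarith
    · have h2 := H1 p hp p' hp' 𝔞 𝔞 (fun _ _ => rfl) x hx x hx
        (hpp.trans (min_le_right _ _)) (by simpa using hη1.le)
      have h1 := hg.c1 𝔞 p hpP x (S.X_subset hx)
      obtain ⟨a1, a2⟩ := slice_fderiv S.P'_open S.X'_open hr (S.smooth 𝔞) hpP (S.X_subset hx)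
      obtain ⟨b1, b2⟩ := slice_fderiv S.P'_open S.X'_open hr (hg.sm 𝔞) hpP (S.X_subset hx)
      have h3 : fderiv ℝ (S.f p 𝔞) x - fderiv ℝ (g p 𝔞) x =
          (fderiv ℝ (fun q : E d × E N => S.f q.1 𝔞 q.2 - g q.1 𝔞 q.2) (p, x)).comp
            (ContinuousLinearMap.inr ℝ (E d) (E N)) := by
        have e1 : fderiv ℝ (S.f p 𝔞) x = _ := a1.fderiv
        have e2 : fderiv ℝ (g p 𝔞) x = _ := b1.fderiv
        rw [e1, e2, fderiv_fun_sub a2 b2, ContinuousLinearMap.sub_comp]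
      have h4 : ‖fderiv ℝ (S.f p 𝔞) x - fderiv ℝ (g p 𝔞) x‖ ≤ δ / 2 := by
        rw [h3]
        refine (ContinuousLinearMap.opNorm_comp_le _ _).trans ?_
        refine (mul_le_of_le_one_right (norm_nonneg _)
          (ContinuousLinearMap.norm_inr_le_one ℝ _ _)).trans h1
      rw [norm_sub_rev] at h4
      calc _ = ‖(fderiv ℝ (g p 𝔞) x - fderiv ℝ (S.f p 𝔞) x) +
            (fderiv ℝ (S.f p 𝔞) x - fderiv ℝ (S.f p' 𝔞) x)‖ := by congr 1; abel
        _ ≤ _ := norm_add_le _ _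
        _ ≤ δ := by linarith

lemma local_data [Fintype A] [Nonempty A] (hN : 0 < N) (hr : 2 ≤ r) (S : SkewFamily A N d r)
    (hU : UnipOn hN S.f S.P' S.X') (γ' γ : ℝ) (hγ : GammaBounds hN S.f γ' γ)
    {p0 : E d} (hp0 : p0 ∈ closure (cubeO d)) {s : ℝ} (hs : (N : ℝ) < s) (𝔞 : ℕ → A)
    (hpr : pressure S.f p0 𝔞 s = 0) :
    ∃ ρ > (0:ℝ), ∃ θ1 > (0:ℝ), ∃ (ν : E N → ℝ) (c γ0 γ1 : ℝ), 0 < c ∧ 0 < γ0 ∧ γ0 ≤ 1 ∧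
      ∃ (n : ℕ) (mb : (Fin n → A) → ℝ), (∀ b, 0 < mb b) ∧ (∀ b, mb b ≤ 1) ∧
        1 < ∑ b, mb b ^ N ∧ ∀ p ∈ closure (cubeO d), ‖p - p0‖ ≤ ρ → ∀ g, Adm S θ1 g →
          Contr ν c γ0 γ1 (g p) ∧
          ∀ (b : Fin n → A) (𝔞 : ℕ → A), ∀ x ∈ cube N, ∀ y ∈ cube N, mb b * ν (x - y) ≤
            ν (psiH (g p) (List.ofFn b) 𝔞 x - psiH (g p) (List.ofFn b) 𝔞 y) := by
  obtain ⟨⟨B, hB⟩, hnear⟩ := fam_data hN hr S hU γ' γ hγ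
  have hp : limUnder atTop (fun n : ℕ => (1 / n : ℝ) * Real.log
      (∑ w : Fin n → A, Mop (psiH (S.f p0) (List.ofFn w) 𝔞) ^ s)) = 0 := by
    rw [← hpr, pressure]
    simp only [psi_eq]
  obtain ⟨ν, c, γ0, γ1, δ, hc, hγ0, hγ01, hδ, n, mb, h1, h2, h3, h4⟩ :=
    block_of_pressure hN (hB p0 hp0) hs 𝔞 hp
  obtain ⟨ρ, hρ, h5⟩ := hnear δ hδ
  exact ⟨ρ, hρ, δ / 2, by positivity, ν, c, γ0, γ1, hc, hγ0, hγ01, n, mb, h1, h2, h3,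
    fun p hp hpp g hg => h4 (g p) (h5 p hp p0 hp0 hpp g hg)⟩

end pert

/-! ### Final assembly -/

section final

lemma psi_continuousOn {Q : Type*} [TopologicalSpace Q] {U : Set Q}
    {h : Q → (ℕ → A) → E N → E N}
    (hc : ∀ 𝔞, ContinuousOn (fun z : Q × E N => h z.1 𝔞 z.2) (U ×ˢ cube N))
    (hm : ∀ q ∈ U, ∀ 𝔞, ∀ x ∈ cube N, h q 𝔞 x ∈ cube N) (w : List A) :
    ∀ 𝔞, ContinuousOn (fun q => psiH (h q) w 𝔞 0) U := by
  induction w with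
  | nil => intro 𝔞; exact continuousOn_const
  | cons a w ih =>
    intro 𝔞
    have h1 : ContinuousOn (fun q => (q, psiH (h q) w (consF a 𝔞) 0)) U :=
      continuousOn_id.prodMk (ih (consF a 𝔞))
    exact (hc (consF a 𝔞)).comp h1 fun q hq => ⟨hq, psiH_mem (hm q hq) w _ (zero_mem_cube N)⟩

lemma measurable_pi_indicator {Q : Type*} [TopologicalSpace Q] [MeasurableSpace Q]
    [OpensMeasurableSpace Q] {U : Set Q} (hU : IsOpen U)
    {h : Q → (ℕ → A) → E N → E N}
    (hc : ∀ 𝔞, ContinuousOn (fun z : Q × E N => h z.1 𝔞 z.2) (U ×ˢ cube N))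
    (hm : ∀ q ∈ U, ∀ 𝔞, ∀ x ∈ cube N, h q 𝔞 x ∈ cube N)
    (ht : ∀ q ∈ U, ∀ 𝔞 α, Tendsto (fun n => psiH (h q) (trunc α n) 𝔞 0) atTop
      (𝓝 (piH (h q) 𝔞 α))) (𝔞 α : ℕ → A) :
    Measurable (U.indicator fun q => piH (h q) 𝔞 α) := by
  classical
  refine measurable_of_tendsto_metrizable
    (f := fun n => U.indicator fun q => psiH (h q) (trunc α n) 𝔞 0) (fun n => ?_) ?_
  · rw [← Set.piecewise_eq_indicator]
    exact (psi_continuousOn hc hm _ 𝔞).measurable_piecewise continuousOn_const hU.measurableSet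
  · rw [tendsto_pi_nhds]
    intro q
    by_cases hq : q ∈ U
    · simpa [hq] using ht q hq 𝔞 α
    · simp [hq]

variable {r : ℕ∞}

/-- Local version of the theorem, for a one-parameter family of admissible maps. -/
lemma local_one [Fintype A] [Nonempty A] {S : SkewFamily A N d r} {V : Set (E d)}
    (hV : IsOpen V) (hVc : V ⊆ cubeO d)
    {ν : E N → ℝ} {c γ0 γ1 : ℝ} (hc : 0 < c) (hγ0 : 0 < γ0) (hγ01 : γ0 ≤ 1)
    {n : ℕ} {mb : (Fin n → A) → ℝ} (hmb : ∀ b, 0 < mb b) (hmb1 : ∀ b, mb b ≤ 1)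
    (hZ : 1 < ∑ b, mb b ^ N)
    (hloc : ∀ p ∈ V, Contr ν c γ0 γ1 (S.f p) ∧
          ∀ (b : Fin n → A) (𝔞 : ℕ → A), ∀ x ∈ cube N, ∀ y ∈ cube N, mb b * ν (x - y) ≤
            ν (psiH (S.f p) (List.ofFn b) 𝔞 x - psiH (S.f p) (List.ofFn b) 𝔞 y))
    {C : ℝ} (hC : 0 < C)
    (hT : ∀ 𝔞 α β : ℕ → A, α 0 ≠ β 0 → ∀ rr > (0:ℝ),
      volume {p ∈ cubeO d | ‖piProj S.f p 𝔞 α - piProj S.f p 𝔞 β‖ < rr}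
        ≤ ENNReal.ofReal (C * rr ^ N)) (𝔞 : ℕ → A) :
    ∀ᵐ p ∂(volume.restrict V), 0 < volume (range (piProj S.f p 𝔞)) := by
  have hVP : V ⊆ S.P' := hVc.trans (subset_closure.trans S.P_subset)
  haveI : IsFiniteMeasure (volume.restrict V) :=
    ⟨by rw [Measure.restrict_apply_univ]
        exact (measure_mono hVc).trans_lt (volume_cubeO_lt_top d)⟩
  have hcont : ∀ 𝔞, ContinuousOn (fun z : E d × E N => S.f z.1 𝔞 z.2) (V ×ˢ cube N) :=
    fun 𝔞 => (S.smooth 𝔞).continuousOn.mono (prod_mono hVP S.X_subset)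
  have hm : ∀ q ∈ V, ∀ 𝔞, ∀ x ∈ cube N, S.f q 𝔞 x ∈ cube N := fun q hq 𝔞 x hx =>
    S.into 𝔞 q (hVP hq) ⟨x, S.X_subset hx, rfl⟩
  have hmeas := measurable_pi_indicator hV hcont hm
    (fun q hq 𝔞 α => (hloc q hq).1.pi_tendsto 𝔞 α)
  have key := core (volume.restrict V) S.f hc hγ0 hγ01
    ((ae_restrict_iff' hV.measurableSet).2 (Eventually.of_forall fun q hq => (hloc q hq).1))
    mb hmb hmb1 hZ
    ((ae_restrict_iff' hV.measurableSet).2 (Eventually.of_forall fun q hq => (hloc q hq).2))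
    (fun 𝔞 α => (aemeasurable_indicator_iff hV.measurableSet).1 (hmeas 𝔞 α).aemeasurable)
    hC (fun 𝔞 α β hab ρ hρ => by
      rw [Measure.restrict_apply' hV.measurableSet]
      refine (measure_mono ?_).trans (hT 𝔞 α β hab ρ hρ)
      intro q hq
      refine ⟨hVc hq.2, ?_⟩
      rw [piProj_eq, piProj_eq]
      exact hq.1) 𝔞
  filter_upwards [key] with p hp
  have e : piProj S.f p 𝔞 = piH (S.f p) 𝔞 := funext fun α => piProj_eq _ _ _ _
  rw [e]
  exact hp

/-- Local version of the theorem, for parameterized perturbations. -/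
lemma local_two [Fintype A] [Nonempty A] {hN : 0 < N} {S : SkewFamily A N d r} {V : Set (E d)}
    (hV : IsOpen V) (hVc : V ⊆ cubeO d) {θ : ℝ} {τ : ℕ} (Ft : ParamPerturb hN S θ τ)
    {ν : E N → ℝ} {c γ0 γ1 : ℝ} (hc : 0 < c) (hγ0 : 0 < γ0) (hγ01 : γ0 ≤ 1)
    {n : ℕ} {mb : (Fin n → A) → ℝ} (hmb : ∀ b, 0 < mb b) (hmb1 : ∀ b, mb b ≤ 1)
    (hZ : 1 < ∑ b, mb b ^ N)
    (hloc : ∀ p ∈ V, ∀ t ∈ cubeO τ, Contr ν c γ0 γ1 (Ft.g t p) ∧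
          ∀ (b : Fin n → A) (𝔞 : ℕ → A), ∀ x ∈ cube N, ∀ y ∈ cube N, mb b * ν (x - y) ≤
            ν (psiH (Ft.g t p) (List.ofFn b) 𝔞 x - psiH (Ft.g t p) (List.ofFn b) 𝔞 y))
    {C : ℝ} (hC : 0 < C)
    (hT : ∀ t ∈ cubeO τ, ∀ 𝔞 α β : ℕ → A, α 0 ≠ β 0 → ∀ rr > (0:ℝ),
      volume {p ∈ cubeO d | ‖piProj (Ft.g t) p 𝔞 α - piProj (Ft.g t) p 𝔞 β‖ < rr}
        ≤ ENNReal.ofReal (C * rr ^ N)) (𝔞 : ℕ → A) :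
    ∀ᵐ q ∂((volume : Measure (E d × E τ)).restrict (V ×ˢ cubeO τ)),
      0 < volume (range (piProj (Ft.g q.2) q.1 𝔞)) := by
  have hVP : V ⊆ S.P' := hVc.trans (subset_closure.trans S.P_subset)
  set U : Set (E d × E τ) := V ×ˢ cubeO τ with hUdef
  have hU : IsOpen U := hV.prod (isOpen_cubeO τ)
  have hUm := hU.measurableSet
  set h : E d × E τ → (ℕ → A) → E N → E N := fun q => Ft.g q.2 q.1 with hh
  set Vτ := volume (cubeO τ) with hVτ
  have hVτt : Vτ ≠ ⊤ := (volume_cubeO_lt_top τ).ne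
  haveI : IsFiniteMeasure ((volume : Measure (E d × E τ)).restrict U) :=
    ⟨by rw [Measure.restrict_apply_univ, hUdef, Measure.volume_eq_prod, Measure.prod_prod]
        exact ENNReal.mul_lt_top ((measure_mono hVc).trans_lt (volume_cubeO_lt_top d))
          (volume_cubeO_lt_top τ)⟩
  have hcont : ∀ 𝔞, ContinuousOn (fun z : (E d × E τ) × E N => h z.1 𝔞 z.2) (U ×ˢ cube N) := by
    intro 𝔞
    have h1 : Continuous (fun z : (E d × E τ) × E N => (z.1.2, z.1.1, z.2)) := by fun_prop
    exact (Ft.jointSmooth 𝔞).continuousOn.comp h1.continuousOn fun z hz =>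
      ⟨hz.1.2, hVP hz.1.1, S.X_subset hz.2⟩
  have hm : ∀ q ∈ U, ∀ 𝔞, ∀ x ∈ cube N, h q 𝔞 x ∈ cube N := fun q hq 𝔞 x hx =>
    Ft.into q.2 hq.2 𝔞 q.1 (hVP hq.1) ⟨x, S.X_subset hx, rfl⟩
  have hmeas := measurable_pi_indicator hU hcont hm
    (fun q hq 𝔞 α => (hloc q.1 hq.1 q.2 hq.2).1.pi_tendsto 𝔞 α)
  have hTr : ∀ 𝔞 α β : ℕ → A, α 0 ≠ β 0 → ∀ ρ > (0:ℝ),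
      (volume : Measure (E d × E τ)).restrict U {q | ‖piH (h q) 𝔞 α - piH (h q) 𝔞 β‖ < ρ} ≤
        ENNReal.ofReal ((C * (Vτ.toReal + 1)) * ρ ^ N) := by
    intro 𝔞 α β hab ρ hρ
    rw [Measure.restrict_apply' hUm]
    set s := {q | ‖piH (h q) 𝔞 α - piH (h q) 𝔞 β‖ < ρ} ∩ U with hs
    have hsm : MeasurableSet s := by
      have e : s = {q | ‖(U.indicator (fun q => piH (h q) 𝔞 α)) q -
          (U.indicator (fun q => piH (h q) 𝔞 β)) q‖ < ρ} ∩ U := by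
        ext q
        constructor
        · intro hq
          refine ⟨?_, hq.2⟩
          have h1 : ‖piH (h q) 𝔞 α - piH (h q) 𝔞 β‖ < ρ := hq.1
          show ‖_ - _‖ < ρ
          rw [indicator_of_mem hq.2, indicator_of_mem hq.2]
          exact h1
        · intro hq
          refine ⟨?_, hq.2⟩
          have h1 : ‖(U.indicator (fun q => piH (h q) 𝔞 α)) q -
            (U.indicator (fun q => piH (h q) 𝔞 β)) q‖ < ρ := hq.1
          rw [indicator_of_mem hq.2, indicator_of_mem hq.2] at h1
          exact h1
      rw [e]
      exact (measurableSet_lt ((hmeas 𝔞 α).sub (hmeas 𝔞 β)).norm measurable_const).inter hUm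
    rw [Measure.volume_eq_prod, Measure.prod_apply_symm hsm]
    have hle : ∀ t : E τ, volume ((fun p : E d => (p, t)) ⁻¹' s) ≤
        (cubeO τ).indicator (fun _ => ENNReal.ofReal (C * ρ ^ N)) t := by
      intro t
      by_cases ht : t ∈ cubeO τ
      · rw [indicator_of_mem ht]
        refine (measure_mono ?_).trans (hT t ht 𝔞 α β hab ρ hρ)
        intro p hp
        have hp' : (p, t) ∈ s := hp
        refine ⟨hVc hp'.2.1, ?_⟩
        rw [piProj_eq, piProj_eq]
        exact hp'.1
      · have : (fun p : E d => (p, t)) ⁻¹' s = ∅ := by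
          ext p
          refine ⟨fun hp => ?_, fun hp => absurd hp (by simp)⟩
          have hp' : (p, t) ∈ s := hp
          exact absurd hp'.2.2 ht
        rw [this, measure_empty]
        exact zero_le
    refine (lintegral_mono hle).trans ?_
    rw [lintegral_indicator (isOpen_cubeO τ).measurableSet, setLIntegral_const]
    have h0 : 0 ≤ C * ρ ^ N := by positivity
    calc ENNReal.ofReal (C * ρ ^ N) * Vτ = ENNReal.ofReal (C * ρ ^ N * Vτ.toReal) := by
          rw [ENNReal.ofReal_mul h0, ENNReal.ofReal_toReal hVτt]
      _ ≤ _ := ENNReal.ofReal_le_ofReal (by nlinarith [ENNReal.toReal_nonneg (a := Vτ)])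
  have key := core (volume.restrict U) h hc hγ0 hγ01
    ((ae_restrict_iff' hUm).2 (Eventually.of_forall fun q hq => (hloc q.1 hq.1 q.2 hq.2).1))
    mb hmb hmb1 hZ
    ((ae_restrict_iff' hUm).2 (Eventually.of_forall fun q hq => (hloc q.1 hq.1 q.2 hq.2).2))
    (fun 𝔞 α => (aemeasurable_indicator_iff hUm).1 (hmeas 𝔞 α).aemeasurable)
    (mul_pos hC (add_pos_of_nonneg_of_pos ENNReal.toReal_nonneg one_pos)) hTr 𝔞
  filter_upwards [key] with q hq
  have e : piProj (Ft.g q.2) q.1 𝔞 = piH (h q) 𝔞 := funext fun α => piProj_eq _ _ _ _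
  rw [e]
  exact hq

lemma exists_pos_le_finset {ι : Type*} (s : Finset ι) (f : ι → ℝ) (hf : ∀ i, 0 < f i) :
    ∃ ε > (0:ℝ), ∀ i ∈ s, ε ≤ f i := by
  classical
  induction s using Finset.induction_on with
  | empty => exact ⟨1, one_pos, by simp⟩
  | insert a s _ ih =>
    obtain ⟨ε, hε, h⟩ := ih
    refine ⟨min ε (f a), lt_min hε (hf a), fun i hi => ?_⟩
    rcases Finset.mem_insert.1 hi with rfl | hi
    · exact min_le_right _ _
    · exact (min_le_left _ _).trans (h i hi)

end final

end aux

/-- Theorem C: positive-measure limit sets inside fibers, robustly under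
parameterized families of U-perturbations. -/
theorem theorem_C {A : Type} [Fintype A] {N d : ℕ} {r : ℕ∞}
    (hA : 2 ≤ Fintype.card A) (hN : 0 < N) (hd : 0 < d) (hr : 2 ≤ r)
    (S : SkewFamily A N d r)
    (hU : UnipOn hN S.f S.P' S.X')
    (γ' γ : ℝ) (hγ : GammaBounds hN S.f γ' γ)
    (hT : TransAssumption hN S)
    (Δ : E d → ℝ)
    (hΔzero : ∀ p ∈ closure (cubeO d), 0 ≤ Δ p ∧ ∀ 𝔞 : ℕ → A, pressure S.f p 𝔞 (Δ p) = 0)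
    (hΔ : ∀ p ∈ closure (cubeO d), (N : ℝ) < Δ p) :
    (∀ 𝔞 : ℕ → A, ∀ᵐ p ∂(volume : Measure (E d)), p ∈ cubeO d →
        0 < volume (Set.range (piProj S.f p 𝔞))) ∧
    ∃ θ₀ > (0:ℝ), ∀ τ : ℕ, 0 < τ → ∀ Ft : ParamPerturb hN S θ₀ τ, ∀ 𝔞 : ℕ → A,
      ∀ᵐ q ∂(volume : Measure (E d × E τ)), (q.1 ∈ cubeO d ∧ q.2 ∈ cubeO τ) →
        0 < volume (Set.range (piProj (Ft.g q.2) q.1 𝔞)) := by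
  haveI : Nonempty A := Fintype.card_pos_iff.1 (by omega)
  obtain ⟨C, hC, hT1, θT, hθT, hT2⟩ := hT
  have hdata := fun z : closure (cubeO d) => local_data hN hr S hU γ' γ hγ z.2 (hΔ z.1 z.2)
    (fun _ => Classical.arbitrary A) ((hΔzero z.1 z.2).2 _)
  choose ρ hρ θ1 hθ1 ν c γ0 γ1 hc hγ0 hγ01 n mb hmb hmb1 hZ hloc using hdata
  obtain ⟨F, hF⟩ := (isCompact_closure_cubeO d).elim_finite_subcover
    (fun z : closure (cubeO d) => Metric.ball z.1 (ρ z)) (fun z => Metric.isOpen_ball)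
    (fun p hp => mem_iUnion.2 ⟨⟨p, hp⟩, Metric.mem_ball_self (hρ _)⟩)
  obtain ⟨ε, hε, hεF⟩ := exists_pos_le_finset F θ1 hθ1
  have hVo : ∀ z : closure (cubeO d), IsOpen (Metric.ball z.1 (ρ z) ∩ cubeO d) := fun z =>
    Metric.isOpen_ball.inter (isOpen_cubeO d)
  have hnear : ∀ z : closure (cubeO d), ∀ p ∈ Metric.ball z.1 (ρ z) ∩ cubeO d,
      p ∈ closure (cubeO d) ∧ ‖p - z.1‖ ≤ ρ z := fun z p hp =>
    ⟨subset_closure hp.2, by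
      rw [← dist_eq_norm]
      exact (Metric.mem_ball.1 hp.1).le⟩
  have hcov : ∀ p ∈ cubeO d, ∃ z ∈ F, p ∈ Metric.ball z.1 (ρ z) ∩ cubeO d := by
    intro p hp
    obtain ⟨z, hz, hpz⟩ := mem_iUnion₂.1 (hF (subset_closure hp))
    exact ⟨z, hz, hpz, hp⟩
  constructor
  · intro 𝔞
    have h1 : ∀ z ∈ F, ∀ᵐ p ∂(volume : Measure (E d)), p ∈ Metric.ball z.1 (ρ z) ∩ cubeO d →
        0 < volume (Set.range (piProj S.f p 𝔞)) := fun z _ =>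
      (ae_restrict_iff' (hVo z).measurableSet).1
        (local_one (hVo z) inter_subset_right (hc z) (hγ0 z) (hγ01 z) (hmb z) (hmb1 z) (hZ z)
          (fun p hp => hloc z p (hnear z p hp).1 (hnear z p hp).2 S.f (adm_self S (hθ1 z).le))
          hC hT1 𝔞)
    have h2 := (Filter.eventually_all_finset F).2 h1
    filter_upwards [h2] with p hp hpc
    obtain ⟨z, hz, hpz⟩ := hcov p hpc
    exact hp z hz hpz
  · refine ⟨min ε θT, lt_min hε hθT, fun τ hτ Ft 𝔞 => ?_⟩
    have h1 : ∀ z ∈ F, ∀ᵐ q ∂(volume : Measure (E d × E τ)),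
        q ∈ (Metric.ball z.1 (ρ z) ∩ cubeO d) ×ˢ cubeO τ →
        0 < volume (Set.range (piProj (Ft.g q.2) q.1 𝔞)) := fun z hz =>
      (ae_restrict_iff' ((hVo z).prod (isOpen_cubeO τ)).measurableSet).1
        (local_two (hVo z) inter_subset_right Ft (hc z) (hγ0 z) (hγ01 z) (hmb z) (hmb1 z) (hZ z)
          (fun p hp t ht => hloc z p (hnear z p hp).1 (hnear z p hp).2 (Ft.g t)
            ((adm_pert hr Ft ht).mono ((min_le_left _ _).trans (hεF z hz))))
          hC (fun t ht => hT2 _ (lt_min hε hθT) (min_le_right _ _) τ hτ Ft t ht) 𝔞)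
    have h2 := (Filter.eventually_all_finset F).2 h1
    filter_upwards [h2] with q hq hqc
    obtain ⟨z, hz, hpz⟩ := hcov q.1 hqc.1
    exact hq z hz ⟨hpz, hqc.2⟩

end Paper
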